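/- arXiv:2008.04307 — 2 statements merged into one kernel-verified Lean document; each statement's English description precedes it below -/
import Mathlib

section
/- Let (V,E) be a finite undirected graph with |V| ≥ 4, equipped with an integer d ≥ 1 and permutations θ₁,…,θ_d of V such that v and θᵢ(v) are adjacent for all v ∈ V and 1 ≤ i ≤ d, and N(v) = ⋃ᵢ{θᵢ(v)} for all v ∈ V. Suppose (V,E) is an ε-vertex expander for some ε > 0 and its normalised adjacency operator has an eigenvalue in the interval (−1, −1+ζ] for some ζ with 0 < ζ ≤ ε²/(4d⁴). Set β = d²·√(2ζ(2−ζ)). Then there is a subset A of V with |V|/(2 + β + dβ/ε) ≤ |A| ≤ |V|/2 such that, for every bijection τ: V → V satisfying N(N(τ(A))) ⊆ τ(N(N(A))), if β < ε²/(2d(2d+1)) then exactly one of the following holds: |A ∩ τ(A)| ≤ (dβ/ε²)(ε + d + 2)|A|, or |A ∩ τ(A)| ≥ (1 − (dβ/ε²)(ε + d + 2))|A|. -/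
/-- The neighbourhood of a set of vertices in a graph with adjacency relation `Adj`. -/
def nbhd {V : Type*} (Adj : V → V → Prop) (A : Set V) : Set V :=
  {w : V | ∃ v ∈ A, Adj v w}

open Finset in
/-- Discrete co-area inequality: a lower bound on the flow out of every nonempty subset of the
support of a nonnegative function bounds the total positive variation of the function from below. -/
lemma mul_sum_le_sum_posPart_sub {V ι : Type*} [Fintype V] [DecidableEq V] [Fintype ι]
    (π : ι → Equiv.Perm V) (h : ℝ) (u : V → ℝ) (hu : ∀ v, 0 ≤ u v)
    (hcut : ∀ A : Finset V, A.Nonempty → (∀ v ∈ A, 0 < u v) →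
      h * #A ≤ ∑ k, (#{v ∈ A | π k v ∉ A} : ℝ)) :
    h * ∑ v, u v ≤ ∑ k, ∑ v, max (u v - u (π k v)) 0 := by
  induction hn : #{v | 0 < u v} using Nat.strong_induction_on generalizing u with
  | _ n ih =>
  set A : Finset V := {v | 0 < u v} with hA
  have mem_A : ∀ v, v ∈ A ↔ 0 < u v := fun v ↦ by simp [hA]
  have zero_of_notMem : ∀ v, v ∉ A → u v = 0 := fun v hv ↦
    le_antisymm (not_lt.1 fun h ↦ hv ((mem_A v).2 h)) (hu v)
  rcases A.eq_empty_or_nonempty with hAe | hAne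
  · have h0 : ∀ v, u v = 0 := fun v ↦ zero_of_notMem v (by simp [hAe])
    simp [h0]
  · obtain ⟨a, haA, hmin⟩ := A.exists_min_image u hAne
    have ha : 0 < u a := (mem_A a).1 haA
    set w : V → ℝ := fun v ↦ if v ∈ A then u v - u a else 0 with hw
    have w_nonneg : ∀ v, 0 ≤ w v := by
      intro v
      by_cases hv : v ∈ A
      · simpa [hw, hv] using hmin v hv
      · simp [hw, hv]
    have w_pos : ∀ v, 0 < w v → 0 < u v := by
      intro v hv
      by_contra hcon
      have : v ∉ A := fun h ↦ hcon ((mem_A v).1 h)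
      simp [hw, this] at hv
    have w_card : #{v | 0 < w v} < n := by
      rw [← hn]
      refine card_lt_card ((ssubset_iff_of_subset fun v hv ↦ ?_).2 ⟨a, haA, ?_⟩)
      · exact (mem_A v).2 (w_pos v (by simpa using hv))
      · simp [hw, haA]
    have key := ih _ w_card w w_nonneg
      (fun B hB hBw ↦ hcut B hB fun v hv ↦ w_pos v (hBw v hv)) rfl
    have sum_u : ∑ v, u v = ∑ v, w v + u a * #A := by
      have : ∀ v, u v = w v + if v ∈ A then u a else 0 := by
        intro v
        by_cases hv : v ∈ A
        · simp [hw, hv]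
        · simp [hw, hv, zero_of_notMem v hv]
      rw [sum_congr rfl fun v _ ↦ this v, sum_add_distrib, ← sum_filter]
      simp [mul_comm]
    have sum_var : ∀ k, ∑ v, max (u v - u (π k v)) 0 =
        ∑ v, max (w v - w (π k v)) 0 + u a * #{v ∈ A | π k v ∉ A} := by
      intro k
      have : ∀ v, max (u v - u (π k v)) 0 = max (w v - w (π k v)) 0 +
          if v ∈ A ∧ π k v ∉ A then u a else 0 := by
        intro v
        by_cases hv : v ∈ A <;> by_cases hv' : π k v ∈ A
        · simp [hw, hv, hv']
        · have := hmin v hv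
          have h1 := hu v
          simp only [hw, hv, hv', zero_of_notMem _ hv', if_true, if_false, true_and,
            not_false_eq_true]
          rw [max_eq_left (by linarith), max_eq_left (by linarith)]
          ring
        · have := hmin _ hv'
          have h1 := hu (π k v)
          simp only [hw, hv, hv', zero_of_notMem _ hv, if_true, if_false, false_and]
          rw [max_eq_right (by linarith), max_eq_right (by linarith)]
          ring
        · simp [hw, hv, hv', zero_of_notMem]
      rw [sum_congr rfl fun v _ ↦ this v, sum_add_distrib, ← sum_filter, sum_const]
      have : ({v | v ∈ A ∧ π k v ∉ A} : Finset V) = {v ∈ A | π k v ∉ A} := by ext; simp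
      rw [this, nsmul_eq_mul, mul_comm (u a)]
    have hcutA := mul_le_mul_of_nonneg_left (hcut A hAne fun v hv ↦ (mem_A v).1 hv) ha.le
    rw [sum_congr rfl fun k _ ↦ sum_var k, sum_add_distrib, ← mul_sum, sum_u]
    linarith

open Finset in
/-- Cheeger inequality for the (not necessarily reversible) walk driven by a family of
permutations. -/
lemma exists_cut_le_of_eigenfunction {V ι : Type*} [Fintype V] [DecidableEq V] [Fintype ι]
    (π : ι → Equiv.Perm V) (μ : ℝ) (f : V → ℝ)
    (hf : ∀ v, ∑ k, f (π k v) = Fintype.card ι * μ * f v)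
    (hpos : ∃ v, 0 < f v) :
    ∃ A : Finset V, A.Nonempty ∧ (∀ v ∈ A, 0 < f v) ∧
      ∑ k, (#{v ∈ A | π k v ∉ A} : ℝ) ≤ Fintype.card ι * √(2 * (1 - μ)) * #A := by
  set N : ℝ := (Fintype.card ι : ℝ) with hN
  have hN0 : 0 ≤ N := by positivity
  set g : V → ℝ := fun v ↦ max (f v) 0 with hg
  have g_nonneg : ∀ v, 0 ≤ g v := fun v ↦ le_max_right _ _
  set G : ℝ := ∑ v, g v ^ 2 with hG
  have G_pos : 0 < G := by
    obtain ⟨v, hv⟩ := hpos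
    refine sum_pos' (fun v _ ↦ sq_nonneg _) ⟨v, mem_univ v, ?_⟩
    have : 0 < g v := lt_max_of_lt_left hv
    positivity
  have sum_perm : ∀ k, ∑ v, g (π k v) ^ 2 = G := fun k ↦
    Equiv.sum_comp (π k) fun v ↦ g v ^ 2
  have inner_ge : N * μ * G ≤ ∑ k, ∑ v, g v * g (π k v) := by
    rw [sum_comm, hG, mul_sum]
    refine sum_le_sum fun v _ ↦ ?_
    rw [← mul_sum]
    have h1 : g v * ∑ k, f (π k v) ≤ g v * ∑ k, g (π k v) :=
      mul_le_mul_of_nonneg_left (sum_le_sum fun k _ ↦ le_max_left _ _) (g_nonneg v)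
    rw [hf] at h1
    have h2 : g v * f v = g v ^ 2 := by
      rcases le_total (f v) 0 with h | h
      · simp [hg, h]
      · simp [hg, h, sq]
    calc N * μ * g v ^ 2 = g v * (N * μ * f v) := by rw [← h2]; ring
      _ ≤ _ := h1
  have inner_le : ∑ k, ∑ v, g v * g (π k v) ≤ N * G := by
    have : ∀ k, ∑ v, g v * g (π k v) ≤ G := by
      intro k
      have h1 : ∑ v, g v * g (π k v) ≤ ∑ v, (g v ^ 2 + g (π k v) ^ 2) / 2 :=
        sum_le_sum fun v _ ↦ by nlinarith [sq_nonneg (g v - g (π k v))]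
      rw [← sum_div, sum_add_distrib, sum_perm] at h1
      linarith
    calc _ ≤ ∑ _k : ι, G := sum_le_sum fun k _ ↦ this k
      _ = N * G := by simp [hN]
  have sum_sub : ∑ k, ∑ v, (g v - g (π k v)) ^ 2 ≤ 2 * N * (1 - μ) * G := by
    have : ∀ k, ∑ v, (g v - g (π k v)) ^ 2 = 2 * G - 2 * ∑ v, g v * g (π k v) := by
      intro k
      rw [sum_congr rfl fun v _ ↦ (by ring : (g v - g (π k v)) ^ 2 =
        g v ^ 2 + g (π k v) ^ 2 - 2 * (g v * g (π k v))), sum_sub_distrib, sum_add_distrib,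
        sum_perm, ← mul_sum, ← hG]
      ring
    rw [sum_congr rfl fun k _ ↦ this k, sum_sub_distrib]
    simp only [← mul_sum, sum_const, card_univ, nsmul_eq_mul, ← hN]
    linarith
  have sum_add : ∑ k, ∑ v, (g v + g (π k v)) ^ 2 ≤ 4 * N * G := by
    have : ∀ k, ∑ v, (g v + g (π k v)) ^ 2 = 2 * G + 2 * ∑ v, g v * g (π k v) := by
      intro k
      rw [sum_congr rfl fun v _ ↦ (by ring : (g v + g (π k v)) ^ 2 =
        g v ^ 2 + g (π k v) ^ 2 + 2 * (g v * g (π k v))), sum_add_distrib, sum_add_distrib,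
        sum_perm, ← mul_sum, ← hG]
      ring
    rw [sum_congr rfl fun k _ ↦ this k, sum_add_distrib]
    simp only [← mul_sum, sum_const, card_univ, nsmul_eq_mul, ← hN]
    linarith
  have var_eq : ∑ k, ∑ v, max (g v ^ 2 - g (π k v) ^ 2) 0 =
      (∑ k, ∑ v, |g v - g (π k v)| * (g v + g (π k v))) / 2 := by
    rw [sum_div]
    refine sum_congr rfl fun k _ ↦ ?_
    have h0 : ∑ v, (g v ^ 2 - g (π k v) ^ 2) = 0 := by
      rw [sum_sub_distrib, sum_perm, sub_self]
    have h1 : ∀ v, max (g v ^ 2 - g (π k v) ^ 2) 0 =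
        (|g v - g (π k v)| * (g v + g (π k v)) + (g v ^ 2 - g (π k v) ^ 2)) / 2 := by
      intro v
      have h2 : |g v - g (π k v)| * (g v + g (π k v)) = |g v ^ 2 - g (π k v) ^ 2| := by
        rw [sq_sub_sq, abs_mul, abs_of_nonneg (add_nonneg (g_nonneg v) (g_nonneg (π k v))), mul_comm]
      rw [h2]
      rcases le_total 0 (g v ^ 2 - g (π k v) ^ 2) with h | h
      · rw [max_eq_left h, abs_of_nonneg h]
        ring
      · rw [max_eq_right h, abs_of_nonpos h]
        ring
    rw [sum_congr rfl fun v _ ↦ h1 v, ← sum_div, sum_add_distrib, h0, add_zero]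
  have cauchy : (∑ k, ∑ v, |g v - g (π k v)| * (g v + g (π k v))) ^ 2 ≤
      (∑ k, ∑ v, (g v - g (π k v)) ^ 2) * ∑ k, ∑ v, (g v + g (π k v)) ^ 2 := by
    have := sum_mul_sq_le_sq_mul_sq (univ : Finset (ι × V))
      (fun p ↦ |g p.2 - g (π p.1 p.2)|) (fun p ↦ g p.2 + g (π p.1 p.2))
    simpa only [Fintype.sum_prod_type, sq_abs] using this
  have var_le : ∑ k, ∑ v, max (g v ^ 2 - g (π k v) ^ 2) 0 ≤ N * √(2 * (1 - μ)) * G := by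
    rw [var_eq]
    rcases hN0.eq_or_lt with h0 | hNpos
    · have : IsEmpty ι := by
        rw [← Fintype.card_eq_zero_iff]
        rw [hN] at h0
        exact_mod_cast h0.symm
      simp [← h0]
    have hμ : 0 ≤ 1 - μ := by
      have := inner_ge.trans inner_le
      by_contra hcon
      have h3 : 0 < N * G := by positivity
      nlinarith
    have h4 : (∑ k, ∑ v, |g v - g (π k v)| * (g v + g (π k v))) ^ 2 ≤
        (2 * N * √(2 * (1 - μ)) * G) ^ 2 := by
      refine cauchy.trans ((mul_le_mul sum_sub sum_add ?_ ?_).trans_eq ?_)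
      · exact sum_nonneg fun k _ ↦ sum_nonneg fun v _ ↦ sq_nonneg _
      · positivity
      · rw [mul_pow, mul_pow, Real.sq_sqrt (by linarith)]
        ring
    have := (abs_le_of_sq_le_sq' h4 (by positivity)).2
    linarith
  obtain ⟨v₀, hv₀⟩ := hpos
  set F : Finset (Finset V) := {A | A.Nonempty ∧ ∀ v ∈ A, 0 < f v} with hF
  have hFne : F.Nonempty := ⟨{v₀}, by simp [hF, hv₀]⟩
  obtain ⟨A, hAF, hmin⟩ := F.exists_min_image
    (fun A ↦ (∑ k, (#{v ∈ A | π k v ∉ A} : ℝ)) / #A) hFne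
  simp only [hF, mem_filter, mem_univ, true_and] at hAF hmin
  refine ⟨A, hAF.1, hAF.2, ?_⟩
  have hA0 : (0 : ℝ) < #A := by exact_mod_cast hAF.1.card_pos
  have coarea := mul_sum_le_sum_posPart_sub π
    ((∑ k, (#{v ∈ A | π k v ∉ A} : ℝ)) / #A) (fun v ↦ g v ^ 2) (fun v ↦ sq_nonneg _) (by
      intro B hB hBg
      have hB0 : (0 : ℝ) < #B := by exact_mod_cast hB.card_pos
      rw [← le_div_iff₀ hB0]
      refine hmin B ⟨hB, fun v hv ↦ ?_⟩
      by_contra hcon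
      have := hBg v hv
      simp [hg, max_eq_right (not_lt.1 hcon)] at this)
  rw [← div_le_iff₀ hA0]
  exact le_of_mul_le_mul_right (coarea.trans var_le) G_pos

section Neighbourhoods

variable {V : Type*} {Adj : V → V → Prop}

lemma nbhd_mono {A B : Set V} (h : A ⊆ B) : nbhd Adj A ⊆ nbhd Adj B :=
  fun _ ⟨v, hv, hvw⟩ ↦ ⟨v, h hv, hvw⟩

lemma nbhd_union (A B : Set V) : nbhd Adj (A ∪ B) = nbhd Adj A ∪ nbhd Adj B := by
  ext w
  simp only [nbhd, Set.mem_union, Set.mem_ofPred_eq, or_and_right, exists_or]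

lemma nbhd_eq_iUnion_image {d : ℕ} {θ : Fin d → Equiv.Perm V}
    (hN : ∀ v w : V, Adj v w ↔ ∃ i : Fin d, w = θ i v) (A : Set V) :
    nbhd Adj A = ⋃ i, θ i '' A := by
  ext w
  simp only [nbhd, hN, Set.mem_ofPred_eq, Set.mem_iUnion, Set.mem_image]
  constructor
  · rintro ⟨v, hv, i, rfl⟩
    exact ⟨i, v, hv, rfl⟩
  · rintro ⟨i, v, hv, rfl⟩
    exact ⟨v, hv, i, rfl⟩

lemma ncard_nbhd_le {d : ℕ} {θ : Fin d → Equiv.Perm V}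
    (hN : ∀ v w : V, Adj v w ↔ ∃ i : Fin d, w = θ i v) (A : Set V) :
    (nbhd Adj A).ncard ≤ d * A.ncard := by
  rw [nbhd_eq_iUnion_image hN]
  refine (Set.ncard_iUnion_le_of_fintype _).trans_eq ?_
  simp [Set.ncard_image_of_injective _ (Equiv.injective _)]

variable [Fintype V]

lemma ncard_le_ncard_nbhd {d : ℕ} {θ : Fin d → Equiv.Perm V} (i : Fin d)
    (hadj : ∀ v : V, Adj v (θ i v)) (A : Set V) : A.ncard ≤ (nbhd Adj A).ncard := by
  rw [← Set.ncard_image_of_injective A (θ i).injective]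
  refine Set.ncard_le_ncard ?_ (Set.toFinite _)
  rintro _ ⟨v, hv, rfl⟩
  exact ⟨v, hv, hadj v⟩

/-- Exchanging a large set for its complement in a vertex expander. -/
lemma mul_ncard_compl_le {d : ℕ} {θ : Fin d → Equiv.Perm V} {ε : ℝ}
    (hsymm : ∀ v w : V, Adj v w → Adj w v)
    (hN : ∀ v w : V, Adj v w ↔ ∃ i : Fin d, w = θ i v)
    (hexp : ∀ A : Set V, 2 * A.ncard ≤ Fintype.card V →
      ε * (A.ncard : ℝ) ≤ ((nbhd Adj A \ A).ncard : ℝ))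
    (S : Set V) (hS : 2 * Sᶜ.ncard ≤ Fintype.card V) :
    ε * (Sᶜ.ncard : ℝ) ≤ d * ((nbhd Adj S \ S).ncard : ℝ) := by
  refine (hexp _ hS).trans ?_
  have h1 : nbhd Adj Sᶜ \ Sᶜ ⊆ nbhd Adj (nbhd Adj S \ S) := by
    rintro w ⟨⟨v, hv, hvw⟩, hw⟩
    exact ⟨v, ⟨⟨w, not_not.1 hw, hsymm _ _ hvw⟩, hv⟩, hvw⟩
  exact_mod_cast (Set.ncard_le_ncard h1 (Set.toFinite _)).trans (ncard_nbhd_le hN _)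

lemma two_mul_ncard_compl_le {S : Set V} (hS : ¬ 2 * S.ncard ≤ Fintype.card V) :
    2 * Sᶜ.ncard ≤ Fintype.card V := by
  have := Set.ncard_add_ncard_compl S (Set.toFinite _) (Set.toFinite _)
  rw [Nat.card_eq_fintype_card] at this
  omega

/-- A set whose second neighbourhood is barely larger than itself is nearly disjoint from its
neighbourhood. -/
lemma mul_ncard_inter_nbhd_le {ε b : ℝ}
    (hexp : ∀ A : Set V, 2 * A.ncard ≤ Fintype.card V →
      ε * (A.ncard : ℝ) ≤ ((nbhd Adj A \ A).ncard : ℝ))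
    (A : Set V) (hA : 2 * A.ncard ≤ Fintype.card V)
    (hb : ((nbhd Adj (nbhd Adj A) \ A).ncard : ℝ) ≤ b) :
    ε * ((A ∩ nbhd Adj A).ncard : ℝ) ≤ b := by
  have h1 := Set.ncard_le_ncard (Set.inter_subset_left (s := A) (t := nbhd Adj A)) (Set.toFinite _)
  refine (hexp _ (by omega)).trans (le_trans ?_ hb)
  refine Nat.cast_le.2 (Set.ncard_le_ncard ?_ (Set.toFinite _))
  rintro w ⟨hw, hw'⟩
  have h2 := nbhd_mono Set.inter_subset_left hw
  exact ⟨nbhd_mono Set.inter_subset_right hw, fun h ↦ hw' ⟨h, h2⟩⟩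

/-- A set whose second neighbourhood is barely larger than itself covers, together with its
neighbourhood, most of a vertex expander. -/
lemma card_le_of_ncard_nbhd_nbhd_sdiff_le {d : ℕ} {θ : Fin d → Equiv.Perm V} {ε β : ℝ}
    (hε : 0 < ε) (hβε : β < ε) (hd : 1 ≤ d)
    (hsymm : ∀ v w : V, Adj v w → Adj w v)
    (hadj : ∀ (i : Fin d) (v : V), Adj v (θ i v))
    (hN : ∀ v w : V, Adj v w ↔ ∃ i : Fin d, w = θ i v)
    (hexp : ∀ A : Set V, 2 * A.ncard ≤ Fintype.card V →
      ε * (A.ncard : ℝ) ≤ ((nbhd Adj A \ A).ncard : ℝ))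
    (A : Set V) (hA : A.Nonempty)
    (hb : ((nbhd Adj (nbhd Adj A) \ A).ncard : ℝ) ≤ β * A.ncard) :
    (Fintype.card V : ℝ) ≤ (2 + β + d * β / ε) * A.ncard := by
  have hA0 : (0 : ℝ) < A.ncard := by exact_mod_cast (Set.ncard_pos (Set.toFinite _)).2 hA
  set S := A ∪ nbhd Adj A with hS
  have hSb : ((nbhd Adj S \ S).ncard : ℝ) ≤ β * A.ncard := by
    refine le_trans (Nat.cast_le.2 (Set.ncard_le_ncard ?_ (Set.toFinite _))) hb
    rintro w ⟨hw, hw'⟩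
    rw [hS, nbhd_union] at hw
    exact ⟨hw.resolve_left fun h ↦ hw' (Or.inr h), fun h ↦ hw' (Or.inl h)⟩
  have hSlarge : ¬ 2 * S.ncard ≤ Fintype.card V := by
    intro h
    have h1 := (hexp S h).trans hSb
    have h2 : (A.ncard : ℝ) ≤ S.ncard :=
      Nat.cast_le.2 (Set.ncard_le_ncard Set.subset_union_left (Set.toFinite _))
    nlinarith
  have hc := mul_ncard_compl_le hsymm hN hexp S (two_mul_ncard_compl_le hSlarge)
  have hc' : (Sᶜ.ncard : ℝ) ≤ d * β / ε * A.ncard := by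
    rw [div_mul_eq_mul_div, le_div_iff₀ hε]
    have : (d : ℝ) * ((nbhd Adj S \ S).ncard : ℝ) ≤ d * (β * A.ncard) :=
      mul_le_mul_of_nonneg_left hSb (by positivity)
    linarith
  have hNA : ((nbhd Adj A).ncard : ℝ) ≤ (1 + β) * A.ncard := by
    have h1 := ncard_le_ncard_nbhd ⟨0, hd⟩ (hadj _) (nbhd Adj A)
    have h2 : (nbhd Adj (nbhd Adj A)).ncard ≤ (nbhd Adj (nbhd Adj A) \ A).ncard + A.ncard :=
      Set.ncard_le_ncard_sdiff_add_ncard _ _ (Set.toFinite _)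
    have h3 : ((nbhd Adj A).ncard : ℝ) ≤
        (nbhd Adj (nbhd Adj A) \ A).ncard + A.ncard := by exact_mod_cast h1.trans h2
    linarith
  have hSle : (S.ncard : ℝ) ≤ A.ncard + (nbhd Adj A).ncard := by
    exact_mod_cast Set.ncard_union_le A (nbhd Adj A)
  have htot : (S.ncard : ℝ) + Sᶜ.ncard = Fintype.card V := by
    rw [← Nat.card_eq_fintype_card]
    exact_mod_cast Set.ncard_add_ncard_compl S (Set.toFinite _) (Set.toFinite _)
  linarith

/-- Two sets whose second neighbourhoods are barely larger than themselves are either almost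
disjoint or almost nested. -/
lemma ncard_inter_le_or_ncard_sdiff_le {d : ℕ} {θ : Fin d → Equiv.Perm V} {ε b : ℝ}
    (hε : 0 < ε)
    (hsymm : ∀ v w : V, Adj v w → Adj w v)
    (hN : ∀ v w : V, Adj v w ↔ ∃ i : Fin d, w = θ i v)
    (hexp : ∀ A : Set V, 2 * A.ncard ≤ Fintype.card V →
      ε * (A.ncard : ℝ) ≤ ((nbhd Adj A \ A).ncard : ℝ))
    (A B : Set V) (hA : 2 * A.ncard ≤ Fintype.card V)
    (hAb : ((nbhd Adj (nbhd Adj A) \ A).ncard : ℝ) ≤ b)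
    (hBb : ((nbhd Adj (nbhd Adj B) \ B).ncard : ℝ) ≤ b) :
    ε * ((A ∩ B).ncard : ℝ) ≤ 2 * b ∨ ε * ((A \ B).ncard : ℝ) ≤ (2 * d + 1) * b := by
  set S := (A ∩ B) ∪ (nbhd Adj A ∩ nbhd Adj B) with hS
  have hSb : ((nbhd Adj S \ S).ncard : ℝ) ≤ 2 * b := by
    have h1 : nbhd Adj S \ S ⊆ (nbhd Adj (nbhd Adj A) \ A) ∪ (nbhd Adj (nbhd Adj B) \ B) := by
      rintro w ⟨hw, hw'⟩
      rw [hS, nbhd_union] at hw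
      have h2 := hw.resolve_left fun h ↦ hw' (Or.inr
        ⟨nbhd_mono Set.inter_subset_left h, nbhd_mono Set.inter_subset_right h⟩)
      by_cases hwA : w ∈ A
      · exact Or.inr ⟨nbhd_mono Set.inter_subset_right h2, fun hwB ↦ hw' (Or.inl ⟨hwA, hwB⟩)⟩
      · exact Or.inl ⟨nbhd_mono Set.inter_subset_left h2, hwA⟩
    have h3 : ((nbhd Adj S \ S).ncard : ℝ) ≤
        (nbhd Adj (nbhd Adj A) \ A).ncard + (nbhd Adj (nbhd Adj B) \ B).ncard := by
      exact_mod_cast (Set.ncard_le_ncard h1 (Set.toFinite _)).trans (Set.ncard_union_le _ _)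
    linarith
  by_cases hSlarge : 2 * S.ncard ≤ Fintype.card V
  · left
    refine le_trans ?_ ((hexp S hSlarge).trans hSb)
    refine mul_le_mul_of_nonneg_left ?_ hε.le
    exact Nat.cast_le.2 (Set.ncard_le_ncard Set.subset_union_left (Set.toFinite _))
  · right
    have hc := mul_ncard_compl_le hsymm hN hexp S (two_mul_ncard_compl_le hSlarge)
    have hc' : (d : ℝ) * ((nbhd Adj S \ S).ncard : ℝ) ≤ d * (2 * b) :=
      mul_le_mul_of_nonneg_left hSb (by positivity)
    have hi := mul_ncard_inter_nbhd_le hexp A hA hAb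
    have h1 : A \ B ⊆ Sᶜ ∪ (A ∩ nbhd Adj A) := by
      rintro w ⟨hwA, hwB⟩
      by_cases hw : w ∈ nbhd Adj A
      · exact Or.inr ⟨hwA, hw⟩
      · left
        rintro (h | h)
        · exact hwB h.2
        · exact hw h.1
    have h2 : ((A \ B).ncard : ℝ) ≤ Sᶜ.ncard + (A ∩ nbhd Adj A).ncard := by
      exact_mod_cast (Set.ncard_le_ncard h1 (Set.toFinite _)).trans (Set.ncard_union_le _ _)
    have h3 := mul_le_mul_of_nonneg_left h2 hε.le
    linarith

/-- The vertex expansion constant of a `d`-regular graph on at least four vertices is at most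
`d - 1`. -/
lemma vertexExpansion_le {d : ℕ} {θ : Fin d → Equiv.Perm V} {ε : ℝ} (hε : 0 < ε)
    (hV : 4 ≤ Fintype.card V)
    (hsymm : ∀ v w : V, Adj v w → Adj w v)
    (hN : ∀ v w : V, Adj v w ↔ ∃ i : Fin d, w = θ i v)
    (hexp : ∀ A : Set V, 2 * A.ncard ≤ Fintype.card V →
      ε * (A.ncard : ℝ) ≤ ((nbhd Adj A \ A).ncard : ℝ)) :
    ε ≤ d - 1 := by
  obtain ⟨v⟩ : Nonempty V := Fintype.card_pos_iff.1 (by omega)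
  have hv := hexp {v} (by rw [Set.ncard_singleton]; omega)
  rw [Set.ncard_singleton, Nat.cast_one, mul_one] at hv
  obtain ⟨w, ⟨v', rfl, hvw⟩, hwv⟩ : (nbhd Adj {v} \ {v}).Nonempty := by
    rw [← Set.ncard_pos (Set.toFinite _)]
    exact_mod_cast hε.trans_le hv
  have hne : v' ≠ w := fun h ↦ hwv h.symm
  have hdeg : ∀ x y, Adj x y → ((nbhd Adj {x} \ {y}).ncard : ℝ) ≤ d - 1 := by
    intro x y hxy
    have hy : y ∈ nbhd Adj {x} := ⟨x, rfl, hxy⟩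
    have h1 := Set.ncard_sdiff_singleton_add_one hy (Set.toFinite _)
    have h2 := ncard_nbhd_le hN {x}
    rw [Set.ncard_singleton, mul_one, ← h1] at h2
    have : ((nbhd Adj {x} \ {y}).ncard : ℝ) + 1 ≤ d := by exact_mod_cast h2
    linarith
  have h1 : nbhd Adj {v', w} \ {v', w} ⊆ (nbhd Adj {v'} \ {w}) ∪ (nbhd Adj {w} \ {v'}) := by
    rintro x ⟨hx, hx'⟩
    rw [Set.insert_eq, nbhd_union] at hx
    simp only [Set.mem_insert_iff, Set.mem_singleton_iff, not_or] at hx'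
    exact hx.imp (fun h ↦ ⟨h, hx'.2⟩) (fun h ↦ ⟨h, hx'.1⟩)
  have h2 := hexp {v', w} (by rw [Set.ncard_pair hne]; omega)
  have h3 : ((nbhd Adj {v', w} \ {v', w}).ncard : ℝ) ≤
      (nbhd Adj {v'} \ {w}).ncard + (nbhd Adj {w} \ {v'}).ncard := by
    exact_mod_cast (Set.ncard_le_ncard h1 (Set.toFinite _)).trans (Set.ncard_union_le _ _)
  have h4 := hdeg v' w hvw
  have h5 := hdeg w v' (hsymm _ _ hvw)
  rw [Set.ncard_pair hne] at h2
  push_cast at h2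
  linarith

end Neighbourhoods

open Finset in
lemma sum_eq_zero_of_sum_perm_eq {V ι : Type*} [Fintype V] [Fintype ι]
    (π : ι → Equiv.Perm V) (c : ℝ) (hc : c ≠ Fintype.card ι) (f : V → ℝ)
    (hf : ∀ v, ∑ k, f (π k v) = c * f v) : ∑ v, f v = 0 := by
  have h1 : ∑ v, ∑ k, f (π k v) = c * ∑ v, f v := by
    rw [mul_sum]
    exact sum_congr rfl fun v _ ↦ hf v
  rw [sum_comm, sum_congr rfl fun k _ ↦ Equiv.sum_comp (π k) f, sum_const, card_univ,
    nsmul_eq_mul] at h1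
  have h2 : (c - Fintype.card ι) * ∑ v, f v = 0 := by linarith
  exact (mul_eq_zero.1 h2).resolve_left (sub_ne_zero.2 hc)

open Finset in
/-- A nonzero function of zero sum is, up to sign, positive somewhere but on at most half of the
points. -/
lemma exists_sign_pos_card_le {V : Type*} [Fintype V] (f : V → ℝ) (hf : f ≠ 0)
    (hsum : ∑ v, f v = 0) :
    ∃ s : ℝ, (∃ v, 0 < s * f v) ∧ 2 * #{v | 0 < s * f v} ≤ Fintype.card V := by
  obtain ⟨v, hv⟩ := Function.ne_iff.1 hf
  have hp : ∃ v, 0 < f v :=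
    (exists_pos_of_sum_zero_of_exists_nonzero f hsum ⟨v, mem_univ v, hv⟩).imp fun _ h ↦ h.2
  have hm : ∃ v, 0 < -f v :=
    (exists_pos_of_sum_zero_of_exists_nonzero (fun v ↦ -f v) (by simp [hsum])
      ⟨v, mem_univ v, neg_ne_zero.2 hv⟩).imp fun _ h ↦ h.2
  have hdisj : Disjoint ({v | 0 < f v} : Finset V) ({v | 0 < -f v} : Finset V) := by
    rw [disjoint_filter]
    intro v _ h1 h2
    linarith
  have hcard := card_le_univ (disjUnion _ _ hdisj)
  rw [card_disjUnion] at hcard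
  by_cases h : 2 * #{v | 0 < f v} ≤ Fintype.card V
  · exact ⟨1, by simpa using hp, by simpa using h⟩
  · exact ⟨-1, by simpa using hm, by simp only [neg_mul, one_mul]; omega⟩

open Finset in
/-- An eigenvalue of the walk close to `-1` yields a set of at most half the vertices which is
almost invariant under taking second neighbourhoods. -/
lemma exists_ncard_nbhd_nbhd_sdiff_le {V : Type*} [Fintype V] [DecidableEq V]
    {Adj : V → V → Prop} {d : ℕ} (hd : 1 ≤ d) {θ : Fin d → Equiv.Perm V}
    (hN : ∀ v w : V, Adj v w ↔ ∃ i : Fin d, w = θ i v)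
    {lam : ℝ} (hlam : lam ≠ 1) {f : V → ℝ} (hf0 : f ≠ 0)
    (hf : ∀ v, ∑ i, f (θ i v) = d * lam * f v) :
    ∃ A : Set V, A.Nonempty ∧ 2 * A.ncard ≤ Fintype.card V ∧
      ((nbhd Adj (nbhd Adj A) \ A).ncard : ℝ) ≤
        (d : ℝ) ^ 2 * √(2 * (1 - lam ^ 2)) * A.ncard := by
  have hd0 : (d : ℝ) ≠ 0 := by exact_mod_cast (by omega : d ≠ 0)
  have hsum : ∑ v, f v = 0 := by
    refine sum_eq_zero_of_sum_perm_eq θ (d * lam) ?_ f hf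
    rw [Fintype.card_fin]
    exact fun h ↦ hlam (mul_left_cancel₀ hd0 (h.trans (mul_one _).symm))
  obtain ⟨s, hs, hcard⟩ := exists_sign_pos_card_le f hf0 hsum
  obtain ⟨A, hAne, hApos, hcut⟩ := exists_cut_le_of_eigenfunction
    (fun p : Fin d × Fin d ↦ θ p.1 * θ p.2) (lam ^ 2) (fun v ↦ s * f v) (by
      intro v
      rw [Fintype.sum_prod_type_right]
      simp only [Equiv.Perm.mul_apply, ← mul_sum, hf, Fintype.card_prod, Fintype.card_fin]
      push_cast
      ring) hs
  refine ⟨A, by simpa using hAne, ?_, ?_⟩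
  · rw [Set.ncard_coe_finset]
    refine le_trans (Nat.mul_le_mul_left 2 (card_le_card fun v hv ↦ ?_)) hcard
    simpa using hApos v hv
  · have hsub : nbhd Adj (nbhd Adj (A : Set V)) \ (A : Set V) ⊆
        ((univ : Finset (Fin d × Fin d)).biUnion fun p ↦
          {v ∈ A | (θ p.1 * θ p.2) v ∉ A}.image (θ p.1 * θ p.2) : Finset V) := by
      rintro w ⟨⟨x, ⟨v, hv, hvx⟩, hxw⟩, hw⟩
      obtain ⟨j, rfl⟩ := (hN _ _).1 hvx
      obtain ⟨i, rfl⟩ := (hN _ _).1 hxw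
      simp only [coe_biUnion, Set.mem_iUnion, mem_coe, mem_image, mem_filter, mem_univ]
      exact ⟨(i, j), trivial, v, ⟨hv, hw⟩, rfl⟩
    have h1 := Set.ncard_le_ncard hsub (Set.toFinite _)
    rw [Set.ncard_coe_finset] at h1
    have h2 : (nbhd Adj (nbhd Adj (A : Set V)) \ (A : Set V)).ncard ≤
        ∑ p : Fin d × Fin d, #{v ∈ A | (θ p.1 * θ p.2) v ∉ A} :=
      h1.trans (card_biUnion_le.trans (sum_le_sum fun p _ ↦ card_image_le))
    rw [Set.ncard_coe_finset]
    have h3 : ((nbhd Adj (nbhd Adj (A : Set V)) \ (A : Set V)).ncard : ℝ) ≤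
        ∑ p : Fin d × Fin d, (#{v ∈ A | (θ p.1 * θ p.2) v ∉ A} : ℝ) := by exact_mod_cast h2
    refine h3.trans (hcut.trans_eq ?_)
    rw [Fintype.card_prod, Fintype.card_fin]
    push_cast
    ring


/-- Let `(V,E)` be a finite undirected graph with `|V| ≥ 4`, equipped with `d ≥ 1`
permutations `θ₁,…,θ_d` of `V` realising the adjacency. Suppose `(V,E)` is an `ε`-vertex
expander with `ε > 0` and its normalised adjacency operator has an eigenvalue
`lam ∈ (-1, -1+ζ]` with `0 < ζ ≤ ε²/(4d⁴)`. Set `β = d²√(2ζ(2-ζ))`. Then there is `A ⊆ V` with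
`|V|/(2+β+dβ/ε) ≤ |A| ≤ |V|/2` such that for every bijection `τ` of `V` with
`N(N(τ(A))) ⊆ τ(N(N(A)))`, if `β < ε²/(2d(2d+1))` then exactly one of
`|A ∩ τ(A)| ≤ (dβ/ε²)(ε+d+2)|A|` and `|A ∩ τ(A)| ≥ (1-(dβ/ε²)(ε+d+2))|A|` holds. -/
theorem stmt_4 {V : Type*} [Fintype V] [DecidableEq V]
    (hV : 4 ≤ Fintype.card V)
    (Adj : V → V → Prop)
    (hundirected : ∀ v w : V, Adj v w → Adj w v)
    (d : ℕ) (hd : 1 ≤ d)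
    (θ : Fin d → Equiv.Perm V)
    (hadj : ∀ (i : Fin d) (v : V), Adj v (θ i v))
    (hN : ∀ v w : V, Adj v w ↔ ∃ i : Fin d, w = θ i v)
    (ε : ℝ) (hε : 0 < ε)
    (hexp : ∀ A : Set V, A.Nonempty → 2 * A.ncard ≤ Fintype.card V →
      ε * (A.ncard : ℝ) ≤ ((nbhd Adj A \ A).ncard : ℝ))
    (ζ : ℝ) (hζ0 : 0 < ζ) (hζ1 : ζ ≤ ε ^ 2 / (4 * (d : ℝ) ^ 4))
    (lam : ℝ) (hlam1 : -1 < lam) (hlam2 : lam ≤ -1 + ζ)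
    (hlameig : ∃ f : V → ℝ, f ≠ 0 ∧ ∀ v : V,
      (∑ w : V, ((Finset.univ.filter (fun i : Fin d => θ i v = w)).card : ℝ) / (d : ℝ) * f w)
        = lam * f v)
    (β : ℝ) (hβ : β = (d : ℝ) ^ 2 * Real.sqrt (2 * ζ * (2 - ζ))) :
    ∃ A : Set V,
      ((Fintype.card V : ℝ) / (2 + β + (d : ℝ) * β / ε) ≤ (A.ncard : ℝ)) ∧
      ((A.ncard : ℝ) ≤ (Fintype.card V : ℝ) / 2) ∧
      ∀ τ : Equiv.Perm V,
        nbhd Adj (nbhd Adj (⇑τ '' A)) ⊆ ⇑τ '' nbhd Adj (nbhd Adj A) →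
        β < ε ^ 2 / (2 * (d : ℝ) * (2 * (d : ℝ) + 1)) →
        Xor'
          (((A ∩ ⇑τ '' A).ncard : ℝ) ≤ ((d : ℝ) * β / ε ^ 2) * (ε + (d : ℝ) + 2) * (A.ncard : ℝ))
          ((1 - ((d : ℝ) * β / ε ^ 2) * (ε + (d : ℝ) + 2)) * (A.ncard : ℝ)
            ≤ ((A ∩ ⇑τ '' A).ncard : ℝ)) := by
  have hexp' : ∀ A : Set V, 2 * A.ncard ≤ Fintype.card V →
      ε * (A.ncard : ℝ) ≤ ((nbhd Adj A \ A).ncard : ℝ) := by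
    intro A hA
    rcases A.eq_empty_or_nonempty with rfl | hne
    · simp
    · exact hexp A hne hA
  have hεd : ε ≤ d - 1 := vertexExpansion_le hε hV hundirected hN hexp'
  have hd1 : (1 : ℝ) ≤ d := by exact_mod_cast hd
  have hζ1' : 4 * (d : ℝ) ^ 4 * ζ ≤ ε ^ 2 := by
    rw [le_div_iff₀ (by positivity)] at hζ1
    linarith
  have hζlt : ζ < 1 := by
    have h1 : ε ^ 2 ≤ (d : ℝ) ^ 2 := by gcongr; linarith
    have h2 : (d : ℝ) ^ 2 * 1 ≤ (d : ℝ) ^ 2 * (d : ℝ) ^ 2 := by gcongr; exact one_le_pow₀ hd1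
    have h3 : 0 < (d : ℝ) ^ 4 := by positivity
    nlinarith
  have hβ0 : 0 ≤ β := by rw [hβ]; positivity
  have hβε : β < ε := by
    refine lt_of_pow_lt_pow_left₀ 2 hε.le ?_
    rw [hβ, mul_pow, Real.sq_sqrt (by nlinarith)]
    have : 0 < (d : ℝ) ^ 4 * ζ ^ 2 := by positivity
    nlinarith
  obtain ⟨f, hf0, hf⟩ := hlameig
  have hd0 : (d : ℝ) ≠ 0 := by linarith
  have hf' : ∀ v, ∑ i, f (θ i v) = d * lam * f v := by
    intro v
    rw [mul_assoc, ← hf v, Finset.mul_sum,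
      ← Finset.sum_fiberwise (Finset.univ : Finset (Fin d)) (fun i ↦ θ i v)]
    refine Finset.sum_congr rfl fun w _ ↦ ?_
    rw [Finset.sum_congr rfl fun i hi ↦ congrArg f (Finset.mem_filter.1 hi).2, Finset.sum_const,
      nsmul_eq_mul]
    field_simp
  obtain ⟨A, hAne, hAcard, hAb'⟩ := exists_ncard_nbhd_nbhd_sdiff_le hd hN
    (by linarith : lam ≠ 1) hf0 hf'
  have hA0 : (0 : ℝ) < A.ncard := by exact_mod_cast (Set.ncard_pos (Set.toFinite _)).2 hAne
  have hAb : ((nbhd Adj (nbhd Adj A) \ A).ncard : ℝ) ≤ β * A.ncard := by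
    refine hAb'.trans ?_
    rw [hβ]
    gcongr ?_ * √?_ * _
    nlinarith
  refine ⟨A, ?_, ?_, fun τ hτ hβs ↦ ?_⟩
  · rw [div_le_iff₀ (by positivity), mul_comm]
    exact card_le_of_ncard_nbhd_nbhd_sdiff_le hε hβε hd hundirected hadj hN hexp' A hAne hAb
  · rw [le_div_iff₀ two_pos, mul_comm]
    exact_mod_cast hAcard
  set κ : ℝ := (d * β / ε ^ 2) * (ε + d + 2) with hκ
  have hκ_eq : κ * ε = β * (d * (ε + d + 2)) / ε := by
    rw [hκ]
    field_simp
  have hκ_half : κ < 1 / 2 := by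
    rw [lt_div_iff₀ (by positivity)] at hβs
    rw [hκ, div_mul_eq_mul_div, div_lt_div_iff₀ (by positivity) two_pos]
    have h1 : (d : ℝ) * β * (ε + d + 2) ≤ d * β * (2 * d + 1) :=
      mul_le_mul_of_nonneg_left (by linarith) (by positivity)
    linarith
  have hBb : ((nbhd Adj (nbhd Adj (τ '' A)) \ τ '' A).ncard : ℝ) ≤ β * A.ncard := by
    refine le_trans (Nat.cast_le.2 ?_) hAb
    rw [← Set.ncard_image_of_injective (nbhd Adj (nbhd Adj A) \ A) τ.injective,
      Set.image_sdiff τ.injective]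
    exact Set.ncard_le_ncard (Set.sdiff_subset_sdiff_left hτ) (Set.toFinite _)
  have hκ_of : ∀ {c x : ℝ}, c * ε ≤ d * (ε + d + 2) → ε * x ≤ c * (β * A.ncard) →
      x ≤ κ * A.ncard := by
    intro c x hc hx
    refine le_of_mul_le_mul_left (hx.trans ?_) hε
    have h1 : c ≤ d * (ε + d + 2) / ε := (le_div_iff₀ hε).2 hc
    calc c * (β * A.ncard) ≤ d * (ε + d + 2) / ε * (β * A.ncard) := by gcongr
      _ = κ * ε * A.ncard := by rw [hκ_eq]; ring
      _ = ε * (κ * A.ncard) := by ring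
  have hnot : ¬ (((A ∩ τ '' A).ncard : ℝ) ≤ κ * A.ncard ∧
      (1 - κ) * A.ncard ≤ ((A ∩ τ '' A).ncard : ℝ)) := by
    rintro ⟨h1, h2⟩
    nlinarith
  refine (xor_iff_or_and_not_and _ _).2 ⟨?_, hnot⟩
  rcases ncard_inter_le_or_ncard_sdiff_le hε hundirected hN hexp' A (τ '' A) hAcard hAb hBb
    with h | h
  · exact Or.inl (hκ_of (by nlinarith) h)
  · right
    have h1 := hκ_of (by nlinarith) h
    have h2 : ((A ∩ τ '' A).ncard : ℝ) + (A \ τ '' A).ncard = A.ncard := by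
      exact_mod_cast Set.ncard_inter_add_ncard_sdiff_eq_ncard A (τ '' A) (Set.toFinite _)
    linarith
end

section
/- Let (V,E) be a finite undirected non-bipartite graph with |V| ≥ 4, equipped with an integer d ≥ 1 and permutations θ₁,…,θ_d of V such that v and θᵢ(v) are adjacent for all v ∈ V and 1 ≤ i ≤ d, and N(v) = ⋃ᵢ{θᵢ(v)} for all v ∈ V. Let 𝒢 be a group acting on V on the left such that: (1) no index-two subgroup of 𝒢 acts transitively on V; (2) the action of 𝒢 on V is transitive and every point stabilizer has the same cardinality t; (3) for each 1 ≤ i ≤ d and v ∈ V there is an automorphism or an anti-automorphism ψ_{i,v} of 𝒢 such that either θᵢ(g·v) = ψ_{i,v}(g)·θᵢ(v) for all g ∈ 𝒢, or θᵢ(g·v) = ψ_{i,v}(g⁻¹)·θᵢ(v) for all g ∈ 𝒢; (4) N(N(τ·A)) ⊆ τ·(N(N(A))) for every τ ∈ 𝒢 and every A ⊆ V. If (V,E) is an ε-vertex expander for some ε > 0, then every nontrivial eigenvalue of the normalised adjacency operator of (V,E) is greater than −1 + ε⁴/(2¹²·d⁸). -/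
open Finset
open scoped Pointwise

theorem exists_card_boundary_le_of_sum_le {V E : Type*} [Fintype V] [Fintype E] [DecidableEq V]
    (s t : E → V) (c : ℝ) (u : V → ℝ) (hu : ∀ v, 0 ≤ u v) (hu0 : u ≠ 0)
    (h : ∑ e, max (u (s e) - u (t e)) 0 ≤ c * ∑ v, u v) :
    ∃ A : Finset V, A.Nonempty ∧ (∀ v ∈ A, 0 < u v) ∧
      (#{e | s e ∈ A ∧ t e ∉ A} : ℝ) ≤ c * #A := by
  induction hk : #{v | 0 < u v} using Nat.strong_induction_on generalizing u with
  | _ k ih =>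
    set A : Finset V := {v | 0 < u v} with hA
    have hmem : ∀ v, v ∈ A ↔ 0 < u v := by simp [hA]
    have hzero : ∀ v, v ∉ A → u v = 0 := fun v hv =>
      le_antisymm (not_lt.1 (fun h' => hv ((hmem v).2 h'))) (hu v)
    have hne : A.Nonempty := by
      obtain ⟨v, hv⟩ := Function.ne_iff.1 hu0
      exact ⟨v, (hmem v).2 (lt_of_le_of_ne (hu v) (Ne.symm hv))⟩
    by_cases hb : (#{e | s e ∈ A ∧ t e ∉ A} : ℝ) ≤ c * #A
    · exact ⟨A, hne, fun v hv => (hmem v).1 hv, hb⟩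
    obtain ⟨v₀, hv₀, hmin⟩ := A.exists_min_image u hne
    have hm : 0 < u v₀ := (hmem v₀).1 hv₀
    set w : V → ℝ := fun v => u v - if v ∈ A then u v₀ else 0 with hw
    have hw0 : ∀ v, 0 ≤ w v := by
      intro v
      by_cases hv : v ∈ A
      · simpa [hw, hv] using hmin v hv
      · simpa [hw, hv] using hu v
    have hwu : ∀ v, 0 < w v → 0 < u v := by
      intro v hv
      by_contra hv'
      have hvA : v ∉ A := fun h' => hv' ((hmem v).1 h')
      simp [hw, hvA, hzero v hvA] at hv
    have hsum : ∑ v, u v = ∑ v, w v + u v₀ * #A := by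
      simp [hw, Finset.sum_sub_distrib, mul_comm]
    have hsumE : ∑ e, max (u (s e) - u (t e)) 0
        = ∑ e, max (w (s e) - w (t e)) 0 + u v₀ * #{e | s e ∈ A ∧ t e ∉ A} := by
      rw [Finset.card_filter, Nat.cast_sum, Finset.mul_sum, ← Finset.sum_add_distrib]
      refine Finset.sum_congr rfl fun e _ => ?_
      by_cases h1 : s e ∈ A <;> by_cases h2 : t e ∈ A
      · simp [hw, h1, h2]
      · have := hmin _ h1
        simp only [hw, h1, h2, hzero _ h2, if_true, if_false]
        rw [max_eq_left (by linarith), max_eq_left (by linarith)]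
        simp
      · have := hmin _ h2
        simp only [hw, h1, h2, hzero _ h1, if_true, if_false]
        rw [max_eq_right (by linarith), max_eq_right (by linarith)]
        simp
      · simp [hw, h1, h2]
    have hlt : ∑ e, max (w (s e) - w (t e)) 0 < c * ∑ v, w v := by
      have := mul_lt_mul_of_pos_left (not_le.1 hb) hm
      rw [hsum, hsumE] at h
      linarith
    have hwne : w ≠ 0 := by
      rintro h0
      simp [h0] at hlt
    have hcard : #{v | 0 < w v} < k := by
      rw [← hk]
      refine Finset.card_lt_card ⟨fun v hv => ?_, fun hsub => ?_⟩
      · simp only [Finset.mem_filter, Finset.mem_univ, true_and] at hv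
        exact (hmem v).2 (hwu v hv)
      · have := hsub hv₀
        simp [hw, hv₀] at this
    obtain ⟨B, hB, hBpos, hBle⟩ := ih _ hcard w hw0 hwne hlt.le rfl
    exact ⟨B, hB, fun v hv => hwu v (hBpos v hv), hBle⟩

theorem exists_median {V : Type*} [Fintype V] [Nonempty V] (f : V → ℝ) :
    ∃ m : ℝ, 2 * #{v | m < f v} ≤ Fintype.card V ∧ 2 * #{v | f v < m} ≤ Fintype.card V := by
  classical
  obtain ⟨vmax, -, hmax⟩ := (univ : Finset V).exists_max_image f univ_nonempty
  have hne : ({v | 2 * #{w | f v < f w} ≤ Fintype.card V} : Finset V).Nonempty := by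
    refine ⟨vmax, ?_⟩
    have : ({w | f vmax < f w} : Finset V) = ∅ := by
      ext w; simpa using hmax w (mem_univ w)
    simp [this]
  obtain ⟨v₀, hv₀, hmin⟩ := Finset.exists_min_image _ f hne
  simp only [Finset.mem_filter, Finset.mem_univ, true_and] at hv₀ hmin
  refine ⟨f v₀, hv₀, ?_⟩
  by_cases hlow : ({v | f v < f v₀} : Finset V).Nonempty
  · obtain ⟨v₁, hv₁, hmax₁⟩ := Finset.exists_max_image _ f hlow
    simp only [Finset.mem_filter, Finset.mem_univ, true_and] at hv₁ hmax₁
    have h1 : Fintype.card V < 2 * #{w | f v₁ < f w} := by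
      by_contra hcon
      exact absurd (hmin v₁ (not_lt.1 hcon)) (not_le.2 hv₁)
    have h2 : #{w | f v₁ < f w} ≤ #{w | ¬ f w < f v₀} := by
      refine Finset.card_le_card fun w hw => ?_
      simp only [Finset.mem_filter, Finset.mem_univ, true_and] at hw ⊢
      exact fun hlt => absurd (hmax₁ w hlt) (not_le.2 hw)
    have h3 := Finset.card_filter_add_card_filter_not (s := (univ : Finset V)) (fun w => f w < f v₀)
    rw [Finset.card_univ] at h3
    omega
  · rw [Finset.not_nonempty_iff_eq_empty.1 hlow]
    simp

theorem exists_card_boundary_le_of_nonneg {V E : Type*} [Fintype V] [Fintype E] [DecidableEq V]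
    (s t : E → V) (D : ℝ)
    (hs : ∀ g : V → ℝ, ∑ e, g (s e) = D * ∑ v, g v)
    (hsymm : ∀ F : V → V → ℝ, ∑ e, F (s e) (t e) = ∑ e, F (t e) (s e))
    (c : ℝ) (hc : 0 ≤ c) (h : V → ℝ) (hpos : ∀ v, 0 ≤ h v) (hne : h ≠ 0)
    (hE : D * ∑ e, (h (s e) - h (t e)) ^ 2 ≤ c ^ 2 * ∑ v, h v ^ 2) :
    ∃ A : Finset V, A.Nonempty ∧ (∀ v ∈ A, 0 < h v) ∧
      (#{e | s e ∈ A ∧ t e ∉ A} : ℝ) ≤ c * #A := by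
  set Q := ∑ v, h v ^ 2 with hQ
  have hQ0 : 0 ≤ Q := Finset.sum_nonneg fun v _ => sq_nonneg _
  have hmax : ∀ a b : ℝ, 2 * max (a - b) 0 = |a - b| + (a - b) := by
    intro a b
    rcases le_total 0 (a - b) with hab | hab
    · rw [max_eq_left hab, abs_of_nonneg hab]; ring
    · rw [max_eq_right hab, abs_of_nonpos hab]; ring
  have hzero : ∑ e, (h (s e) ^ 2 - h (t e) ^ 2) = 0 := by
    rw [Finset.sum_sub_distrib, hsymm (fun a _ => h a ^ 2), sub_self]
  have hhalf : 2 * ∑ e, max (h (s e) ^ 2 - h (t e) ^ 2) 0 = ∑ e, |h (s e) ^ 2 - h (t e) ^ 2| := by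
    rw [Finset.mul_sum, Finset.sum_congr rfl fun e _ => hmax _ _, Finset.sum_add_distrib, hzero,
      add_zero]
  have hplus : ∑ e, (h (s e) + h (t e)) ^ 2 ≤ 4 * D * Q := by
    have h1 : ∑ e, (h (s e) + h (t e)) ^ 2 ≤ ∑ e, (2 * h (s e) ^ 2 + 2 * h (t e) ^ 2) :=
      Finset.sum_le_sum fun e _ => by nlinarith [sq_nonneg (h (s e) - h (t e))]
    rw [Finset.sum_add_distrib, ← Finset.mul_sum, ← Finset.mul_sum,
      ← hsymm (fun a _ => h a ^ 2), hs (fun a => h a ^ 2)] at h1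
    linarith
  have hCS : (∑ e, |h (s e) ^ 2 - h (t e) ^ 2|) ^ 2 ≤ (2 * c * Q) ^ 2 := by
    have h1 := Finset.sum_mul_sq_le_sq_mul_sq univ (fun e => |h (s e) - h (t e)|)
      (fun e => |h (s e) + h (t e)|)
    simp only [sq_abs, ← abs_mul] at h1
    have h2 : ∀ e, (h (s e) - h (t e)) * (h (s e) + h (t e)) = h (s e) ^ 2 - h (t e) ^ 2 :=
      fun e => by ring
    simp only [h2] at h1
    have hE0 : 0 ≤ ∑ e, (h (s e) - h (t e)) ^ 2 := Finset.sum_nonneg fun e _ => sq_nonneg _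
    nlinarith [mul_le_mul_of_nonneg_left hplus hE0, mul_le_mul_of_nonneg_right hE hQ0]
  have hle := abs_le_of_sq_le_sq' hCS (by positivity)
  obtain ⟨A, hA, hApos, hAle⟩ := exists_card_boundary_le_of_sum_le s t c (fun v => h v ^ 2)
    (fun v => sq_nonneg _)
    (by
      obtain ⟨v, hv⟩ := Function.ne_iff.1 hne
      exact Function.ne_iff.2 ⟨v, pow_ne_zero 2 hv⟩)
    (by linarith [hle.2])
  exact ⟨A, hA, fun v hv => lt_of_le_of_ne (hpos v) fun h0 => by
    have := hApos v hv
    simp [← h0] at this, hAle⟩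

/-- The discrete Cheeger inequality for a symmetric multigraph. -/
theorem exists_card_boundary_le {V E : Type*} [Fintype V] [Fintype E] [DecidableEq V]
    (s t : E → V) (D : ℝ) (hD : 0 ≤ D)
    (hs : ∀ g : V → ℝ, ∑ e, g (s e) = D * ∑ v, g v)
    (hsymm : ∀ F : V → V → ℝ, ∑ e, F (s e) (t e) = ∑ e, F (t e) (s e))
    (c : ℝ) (hc : 0 ≤ c) (f : V → ℝ) (hf : f ≠ 0) (hf0 : ∑ v, f v = 0)
    (hE : D * ∑ e, (f (s e) - f (t e)) ^ 2 ≤ c ^ 2 * ∑ v, f v ^ 2) :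
    ∃ A : Finset V, A.Nonempty ∧ 2 * #A ≤ Fintype.card V ∧
      (#{e | s e ∈ A ∧ t e ∉ A} : ℝ) ≤ c * #A := by
  have hV : Nonempty V := (Function.ne_iff.1 hf).nonempty
  obtain ⟨m, hm₁, hm₂⟩ := exists_median f
  set p : V → ℝ := fun v => max (f v - m) 0 with hp
  set q : V → ℝ := fun v => max (m - f v) 0 with hq
  have hpq : ∀ v, p v - q v = f v - m ∧ p v * q v = 0 ∧ 0 ≤ p v ∧ 0 ≤ q v := by
    intro v
    rcases le_total (f v) m with hv | hv
    · simp only [hp, hq]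
      rw [max_eq_right (by linarith), max_eq_left (by linarith)]
      exact ⟨by ring, by ring, le_rfl, by linarith⟩
    · simp only [hp, hq]
      rw [max_eq_left (by linarith), max_eq_right (by linarith)]
      exact ⟨by ring, by ring, by linarith, le_rfl⟩
  have hsq : ∑ v, f v ^ 2 ≤ ∑ v, p v ^ 2 + ∑ v, q v ^ 2 := by
    have h1 : ∀ v, p v ^ 2 + q v ^ 2 = f v ^ 2 - 2 * m * f v + m ^ 2 := by
      intro v
      obtain ⟨h1, h2, -, -⟩ := hpq v
      have : f v = p v - q v + m := by linarith
      rw [this]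
      linear_combination 2 * h2
    rw [← Finset.sum_add_distrib, Finset.sum_congr rfl fun v _ => h1 v, Finset.sum_add_distrib,
      Finset.sum_sub_distrib, ← Finset.mul_sum, hf0]
    have : 0 ≤ ∑ _v : V, m ^ 2 := Finset.sum_nonneg fun v _ => sq_nonneg m
    linarith
  have hen : ∑ e, (p (s e) - p (t e)) ^ 2 + ∑ e, (q (s e) - q (t e)) ^ 2
      ≤ ∑ e, (f (s e) - f (t e)) ^ 2 := by
    rw [← Finset.sum_add_distrib]
    refine Finset.sum_le_sum fun e _ => ?_
    obtain ⟨h1, h2, h3, h4⟩ := hpq (s e)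
    obtain ⟨h5, h6, h7, h8⟩ := hpq (t e)
    have : f (s e) - f (t e) = (p (s e) - p (t e)) - (q (s e) - q (t e)) := by linarith
    rw [this]
    nlinarith [mul_nonneg h3 h8, mul_nonneg h4 h7]
  have hc2 : 0 ≤ c ^ 2 := sq_nonneg c
  have hsum : D * ∑ e, (p (s e) - p (t e)) ^ 2 + D * ∑ e, (q (s e) - q (t e)) ^ 2
      ≤ c ^ 2 * ∑ v, p v ^ 2 + c ^ 2 * ∑ v, q v ^ 2 := by
    nlinarith [mul_le_mul_of_nonneg_left hen hD, mul_le_mul_of_nonneg_left hsq hc2]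
  have hsqpos : 0 < ∑ v, f v ^ 2 := by
    obtain ⟨v, hv⟩ := Function.ne_iff.1 hf
    exact Finset.sum_pos' (fun v _ => sq_nonneg _) ⟨v, mem_univ v, by
      have : f v ≠ 0 := hv
      positivity⟩
  have hsupp : ∀ g : V → ℝ, 2 * #{v | 0 < g v} ≤ Fintype.card V →
      (∃ A : Finset V, A.Nonempty ∧ (∀ v ∈ A, 0 < g v) ∧
        (#{e | s e ∈ A ∧ t e ∉ A} : ℝ) ≤ c * #A) →
      ∃ A : Finset V, A.Nonempty ∧ 2 * #A ≤ Fintype.card V ∧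
        (#{e | s e ∈ A ∧ t e ∉ A} : ℝ) ≤ c * #A := by
    rintro g hg ⟨A, hA, hApos, hAle⟩
    refine ⟨A, hA, ?_, hAle⟩
    have : #A ≤ #{v | 0 < g v} := Finset.card_le_card fun v hv => by simpa using hApos v hv
    omega
  have hp1 : 2 * #{v | 0 < p v} ≤ Fintype.card V := by simpa [hp] using hm₁
  have hq1 : 2 * #{v | 0 < q v} ≤ Fintype.card V := by simpa [hq] using hm₂
  have hEp0 : 0 ≤ D * ∑ e, (p (s e) - p (t e)) ^ 2 :=
    mul_nonneg hD (Finset.sum_nonneg fun e _ => sq_nonneg _)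
  have hEq0 : 0 ≤ D * ∑ e, (q (s e) - q (t e)) ^ 2 :=
    mul_nonneg hD (Finset.sum_nonneg fun e _ => sq_nonneg _)
  by_cases hp0 : p = 0
  · have hz : ∑ v, p v ^ 2 = 0 := by simp [hp0]
    rw [hz] at hsum hsq
    refine hsupp q hq1 (exists_card_boundary_le_of_nonneg s t D hs hsymm c hc q
      (fun v => (hpq v).2.2.2) ?_ (by linarith))
    rintro hq0
    simp [hq0] at hsq
    linarith
  by_cases hpE : D * ∑ e, (p (s e) - p (t e)) ^ 2 ≤ c ^ 2 * ∑ v, p v ^ 2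
  · exact hsupp p hp1 (exists_card_boundary_le_of_nonneg s t D hs hsymm c hc p
      (fun v => (hpq v).2.2.1) hp0 hpE)
  · refine hsupp q hq1 (exists_card_boundary_le_of_nonneg s t D hs hsymm c hc q
      (fun v => (hpq v).2.2.2) ?_ (by linarith))
    rintro hq0
    have hz : ∑ v, q v ^ 2 = 0 := by simp [hq0]
    rw [hz] at hsum
    linarith

open Classical in
/-- The finset version of `nbhd`. -/
noncomputable def nbhdFinset {V : Type*} [Fintype V] (Adj : V → V → Prop) (A : Finset V) :
    Finset V :=
  univ.filter fun w => ∃ v ∈ A, Adj v w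

section nbhdFinset

variable {V : Type*} [Fintype V] {Adj : V → V → Prop}

theorem mem_nbhdFinset {A : Finset V} {w : V} : w ∈ nbhdFinset Adj A ↔ ∃ v ∈ A, Adj v w := by
  simp [nbhdFinset]

theorem coe_nbhdFinset (A : Finset V) : (nbhdFinset Adj A : Set V) = nbhd Adj (A : Set V) := by
  ext w; simp [mem_nbhdFinset, nbhd]

theorem nbhdFinset_mono {A B : Finset V} (h : A ⊆ B) : nbhdFinset Adj A ⊆ nbhdFinset Adj B := by
  intro w hw
  obtain ⟨v, hv, hvw⟩ := mem_nbhdFinset.1 hw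
  exact mem_nbhdFinset.2 ⟨v, h hv, hvw⟩

theorem card_nbhdFinset_le [DecidableEq V] {d : ℕ} {θ : Fin d → Equiv.Perm V}
    (hN : ∀ v w : V, Adj v w ↔ ∃ i : Fin d, w = θ i v) (A : Finset V) :
    #(nbhdFinset Adj A) ≤ d * #A := by
  have hsub : nbhdFinset Adj A ⊆ (univ : Finset (Fin d)).biUnion fun i => A.image (θ i) := by
    intro w hw
    obtain ⟨v, hv, hvw⟩ := mem_nbhdFinset.1 hw
    obtain ⟨i, rfl⟩ := (hN v w).1 hvw
    simp only [Finset.mem_biUnion, Finset.mem_univ, true_and]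
    exact ⟨i, Finset.mem_image_of_mem _ hv⟩
  refine (Finset.card_le_card hsub).trans ?_
  simpa using Finset.card_biUnion_le_card_mul (univ : Finset (Fin d)) (fun i => A.image (θ i)) #A
    fun i _ => Finset.card_image_le

theorem card_le_card_nbhdFinset [DecidableEq V] (θ : Equiv.Perm V) (hadj : ∀ v, Adj v (θ v))
    (A : Finset V) : #A ≤ #(nbhdFinset Adj A) := by
  rw [← Finset.card_image_of_injective A θ.injective]
  refine Finset.card_le_card fun w hw => ?_
  obtain ⟨v, hv, rfl⟩ := Finset.mem_image.1 hw
  exact mem_nbhdFinset.2 ⟨v, hv, hadj v⟩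

/-- In an expander, a set which is almost invariant under the two-step neighbourhood is either
small or has almost half of the vertices. -/
theorem small_or_large_of_card_sdiff_le [DecidableEq V] {d : ℕ} {θ : Fin d → Equiv.Perm V}
    (hd : 1 ≤ d) (hsymm : ∀ v w : V, Adj v w → Adj w v)
    (hN : ∀ v w : V, Adj v w ↔ ∃ i : Fin d, w = θ i v) {ε : ℝ} (hε : 0 < ε)
    (hexp : ∀ A : Finset V, A.Nonempty → 2 * #A ≤ Fintype.card V →
      ε * #A ≤ #(nbhdFinset Adj A \ A)) {B : Finset V} {r : ℝ}
    (hr : (#(nbhdFinset Adj (nbhdFinset Adj B) \ B) : ℝ) ≤ r) :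
    ε * #B ≤ r ∨ ε * (Fintype.card V - 2 * #B - r) ≤ d * r := by
  have hr0 : 0 ≤ r := (Nat.cast_nonneg _).trans hr
  set N := nbhdFinset Adj with hNdef
  set W := B ∪ N B with hW
  have hNW : N W \ W ⊆ N (N B) \ B := by
    intro w hw
    obtain ⟨h1, h2⟩ := Finset.mem_sdiff.1 hw
    rw [hW, Finset.mem_union, not_or] at h2
    obtain ⟨v, hv, hvw⟩ := mem_nbhdFinset.1 h1
    rcases Finset.mem_union.1 hv with hv | hv
    · exact absurd (mem_nbhdFinset.2 ⟨v, hv, hvw⟩) h2.2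
    · exact Finset.mem_sdiff.2 ⟨mem_nbhdFinset.2 ⟨v, hv, hvw⟩, h2.1⟩
  have hNWr : (#(N W \ W) : ℝ) ≤ r := le_trans (mod_cast Finset.card_le_card hNW) hr
  by_cases hsmall : 2 * #W ≤ Fintype.card V
  · left
    rcases B.eq_empty_or_nonempty with rfl | hB
    · simpa using hr0
    have h1 := hexp W (hB.mono Finset.subset_union_left) hsmall
    have h2 : (#B : ℝ) ≤ #W := mod_cast Finset.card_le_card Finset.subset_union_left
    nlinarith
  · right
    have hcompl : #Wᶜ + #W = Fintype.card V := Finset.card_compl_add_card W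
    have hsub : N Wᶜ \ Wᶜ ⊆ N (N W \ W) := by
      intro y hy
      obtain ⟨h1, -⟩ := Finset.mem_sdiff.1 hy
      obtain ⟨x, hx, hxy⟩ := mem_nbhdFinset.1 h1
      have hyW : y ∈ W := by simpa using (Finset.mem_sdiff.1 hy).2
      exact mem_nbhdFinset.2 ⟨x, Finset.mem_sdiff.2 ⟨mem_nbhdFinset.2 ⟨y, hyW, hsymm _ _ hxy⟩,
        Finset.mem_compl.1 hx⟩, hxy⟩
    have hWc : ε * #Wᶜ ≤ d * r := by
      rcases Wᶜ.eq_empty_or_nonempty with h0 | hne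
      · rw [h0]; simpa using mul_nonneg d.cast_nonneg hr0
      have h1 := hexp Wᶜ hne (by omega)
      have h2 : (#(N Wᶜ \ Wᶜ) : ℝ) ≤ d * #(N W \ W) := by
        exact_mod_cast (Finset.card_le_card hsub).trans (card_nbhdFinset_le hN _)
      have h3 : (d : ℝ) * #(N W \ W) ≤ d * r := mul_le_mul_of_nonneg_left hNWr d.cast_nonneg
      linarith
    have hNB : #(N B) ≤ #(N (N B) \ B) + #B := by
      have h1 : #(N B) ≤ #(N (N B)) :=
        card_le_card_nbhdFinset (θ ⟨0, hd⟩) (fun v => (hN v _).2 ⟨_, rfl⟩) (N B)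
      have h2 : #(N (N B)) ≤ #(N (N B) \ B) + #B := Finset.card_le_card_sdiff_add_card
      omega
    have hWle : #W ≤ #B + #(N B) := Finset.card_union_le _ _
    have hWle' : (#W : ℝ) ≤ 2 * #B + r := by
      have : (#W : ℝ) ≤ #B + (#(N (N B) \ B) + #B) := by exact_mod_cast by omega
      linarith
    have hcompl' : (#Wᶜ : ℝ) + #W = Fintype.card V := mod_cast hcompl
    refine le_trans (mul_le_mul_of_nonneg_left ?_ hε.le) hWc
    linarith

/-- In an expander, a set which is almost invariant under the two-step neighbourhood meets its
neighbourhood in a small set. -/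
theorem mul_card_inter_nbhdFinset_le [DecidableEq V] {ε : ℝ}
    (hexp : ∀ A : Finset V, A.Nonempty → 2 * #A ≤ Fintype.card V →
      ε * #A ≤ #(nbhdFinset Adj A \ A)) {A : Finset V} (hA : 2 * #A ≤ Fintype.card V) :
    ε * #(A ∩ nbhdFinset Adj A) ≤ #(nbhdFinset Adj (nbhdFinset Adj A) \ A) := by
  set N := nbhdFinset Adj with hNdef
  rcases (A ∩ N A).eq_empty_or_nonempty with h0 | hne
  · rw [h0]; simp
  have hcard : #(A ∩ N A) ≤ #A := Finset.card_le_card Finset.inter_subset_left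
  refine (hexp _ hne (by omega)).trans ?_
  exact_mod_cast Finset.card_le_card fun w hw => by
    obtain ⟨h1, h2⟩ := Finset.mem_sdiff.1 hw
    refine Finset.mem_sdiff.2 ⟨nbhdFinset_mono Finset.inter_subset_right h1, fun hwA => ?_⟩
    exact h2 (Finset.mem_inter.2 ⟨hwA, nbhdFinset_mono Finset.inter_subset_left h1⟩)

end nbhdFinset

section Action

variable {V : Type*} [Fintype V] [DecidableEq V] {𝒢 : Type*} [Group 𝒢] [MulAction 𝒢 V]

omit [DecidableEq V] in
theorem finite_of_ncard_smul_eq [Nonempty V] {t : ℕ} (ht : 0 < t)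
    (htrans : ∀ u v : V, {g : 𝒢 | g • u = v}.ncard = t) : Finite 𝒢 := by
  obtain ⟨u⟩ := ‹Nonempty V›
  have h : (⋃ v : V, {g : 𝒢 | g • u = v}).Finite :=
    Set.finite_iUnion fun v => Set.finite_of_ncard_pos (by rw [htrans]; exact ht)
  refine Set.finite_univ_iff.1 (h.subset fun g _ => ?_)
  simp

theorem card_eq_mul_card_of_ncard_smul_eq [Fintype 𝒢] [Nonempty V] {t : ℕ}
    (htrans : ∀ u v : V, {g : 𝒢 | g • u = v}.ncard = t) :
    Fintype.card 𝒢 = t * Fintype.card V := by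
  obtain ⟨u⟩ := ‹Nonempty V›
  have h := Finset.card_eq_sum_card_fiberwise (s := (univ : Finset 𝒢)) (t := (univ : Finset V))
    (f := fun g => g • u) (fun _ _ => by simp)
  have hfib : ∀ v : V, #{g : 𝒢 | g • u = v} = t := fun v => by
    rw [← htrans u v, ← Set.ncard_coe_finset]; simp
  rw [Finset.card_univ, Finset.sum_congr rfl fun v _ => hfib v] at h
  simpa [mul_comm] using h

omit [Fintype V] in
open Classical in
theorem exists_card_orbit_ge [Fintype 𝒢] {t : ℕ}
    (htrans : ∀ u v : V, {g : 𝒢 | g • u = v}.ncard = t) {A : Finset V} (hA : A.Nonempty)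
    {S : Finset 𝒢} (hS : ∀ τ ∈ S, 15 * #A ≤ 16 * #(A ∩ τ • A)) :
    ∃ a ∈ A, 15 * #S ≤ 16 * t * #{b ∈ A | ∃ τ ∈ S, τ • a = b} := by
  have hle : ∀ a, #{τ ∈ S | τ • a ∈ A} ≤ t * #{b ∈ A | ∃ τ ∈ S, τ • a = b} := by
    intro a
    refine Finset.card_le_mul_card_image_of_maps_to (f := fun τ => τ • a) (fun τ hτ => ?_) t
      fun b _ => ?_
    · obtain ⟨h1, h2⟩ := Finset.mem_filter.1 hτ
      exact Finset.mem_filter.2 ⟨h2, τ, h1, rfl⟩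
    · rw [← htrans a b, ← Set.ncard_coe_finset]
      exact Set.ncard_le_ncard (fun τ hτ => by simp at hτ; exact hτ.2) (Set.toFinite _)
  have hsum : ∑ τ ∈ S, #(A ∩ τ • A) = ∑ a ∈ A, #{τ ∈ S | τ • a ∈ A} := by
    have h1 : ∀ τ : 𝒢, #(A ∩ τ • A) = #{a ∈ A | τ • a ∈ A} := by
      intro τ
      rw [← Finset.card_smul_finset τ {a ∈ A | τ • a ∈ A}]
      congr 1
      ext b
      simp only [Finset.mem_inter, Finset.mem_smul_finset, Finset.mem_filter]
      constructor
      · rintro ⟨hb, a, ha, rfl⟩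
        exact ⟨a, ⟨ha, hb⟩, rfl⟩
      · rintro ⟨a, ⟨ha, hb⟩, rfl⟩
        exact ⟨hb, a, ha, rfl⟩
    simp only [h1, Finset.card_filter]
    exact Finset.sum_comm
  by_contra! hcon
  have h1 : ∑ a ∈ A, 16 * #{τ ∈ S | τ • a ∈ A} < ∑ a ∈ A, 15 * #S :=
    Finset.sum_lt_sum_of_nonempty hA fun a ha => by
      have := hcon a ha
      have := hle a
      nlinarith
  have h2 : ∑ τ ∈ S, 15 * #A ≤ ∑ τ ∈ S, 16 * #(A ∩ τ • A) := Finset.sum_le_sum hS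
  rw [← Finset.mul_sum, ← hsum, Finset.sum_const, smul_eq_mul] at h1
  rw [Finset.sum_const, ← Finset.mul_sum, smul_eq_mul] at h2
  linarith [mul_left_comm #A 15 #S, mul_left_comm #S 15 #A, mul_comm #A #S]

theorem exists_index_two_of_card_inter_smul [Fintype 𝒢] {t : ℕ} (ht : 0 < t)
    (htrans : ∀ u v : V, {g : 𝒢 | g • u = v}.ncard = t) {A : Finset V} (hA : A.Nonempty)
    (hA₁ : 2 * #A ≤ Fintype.card V) (hA₂ : 8 * Fintype.card V ≤ 17 * #A)
    (hdich : ∀ τ : 𝒢, 16 * #(A ∩ τ • A) ≤ #A ∨ 15 * #A ≤ 16 * #(A ∩ τ • A)) :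
    ∃ H : Subgroup 𝒢, H.index = 2 ∧ ∀ τ ∈ H, 15 * #A ≤ 16 * #(A ∩ τ • A) := by
  have hApos := hA.card_pos
  have htri : ∀ σ τ : 𝒢, #(A ∩ σ • A) + #(A ∩ τ • A) ≤ #A + #(σ • A ∩ τ • A) := by
    intro σ τ
    have h1 := Finset.card_union_add_card_inter (A ∩ σ • A) (A ∩ τ • A)
    have h2 : #(A ∩ σ • A ∪ A ∩ τ • A) ≤ #A := Finset.card_le_card
      (Finset.union_subset Finset.inter_subset_left Finset.inter_subset_left)
    have h3 : #((A ∩ σ • A) ∩ (A ∩ τ • A)) ≤ #(σ • A ∩ τ • A) := Finset.card_le_card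
      (Finset.inter_subset_inter Finset.inter_subset_right Finset.inter_subset_right)
    omega
  have htrans' : ∀ σ τ : 𝒢, #(σ • A ∩ τ • A) = #(A ∩ (σ⁻¹ * τ) • A) := by
    intro σ τ
    rw [← Finset.card_smul_finset σ (A ∩ (σ⁻¹ * τ) • A), Finset.smul_finset_inter, smul_smul,
      mul_inv_cancel_left]
  have hinv : ∀ τ : 𝒢, #(A ∩ τ⁻¹ • A) = #(A ∩ τ • A) := by
    intro τ
    have := htrans' τ 1
    rw [one_smul, mul_one] at this
    rw [← this, Finset.inter_comm]
  let H : Subgroup 𝒢 :=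
    { carrier := {τ | 15 * #A ≤ 16 * #(A ∩ τ • A)}
      one_mem' := by simp; omega
      mul_mem' := by
        intro σ τ hσ hτ
        simp only [Set.mem_ofPred_eq] at hσ hτ ⊢
        have h1 := htri σ⁻¹ τ
        rw [htrans', inv_inv, hinv] at h1
        rcases hdich (σ * τ) with h | h <;> omega
      inv_mem' := by
        intro τ hτ
        simp only [Set.mem_ofPred_eq] at hτ ⊢
        rwa [hinv] }
  have hmem : ∀ τ, τ ∈ H ↔ 15 * #A ≤ 16 * #(A ∩ τ • A) := fun τ => Iff.rfl
  refine ⟨H, ?_, fun τ hτ => hτ⟩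
  obtain ⟨σ, hσ⟩ : ∃ σ, σ ∉ H := by
    by_contra! hall
    have : Nonempty V := ⟨hA.choose⟩
    obtain ⟨a, -, ha⟩ := exists_card_orbit_ge htrans hA (S := univ) fun τ _ => hall τ
    rw [Finset.card_univ, card_eq_mul_card_of_ncard_smul_eq htrans] at ha
    have h1 := Finset.card_filter_le A fun b => ∃ τ ∈ (univ : Finset 𝒢), τ • a = b
    have h2 : t * (15 * Fintype.card V) ≤ t * (16 * #A) := by
      refine le_trans (le_of_eq (by ring)) (ha.trans ?_)
      rw [mul_comm 16 t, mul_assoc]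
      exact Nat.mul_le_mul_left _ (Nat.mul_le_mul_left _ (by convert h1))
    have h3 := Nat.le_of_mul_le_mul_left h2 ht
    omega
  refine Subgroup.index_eq_two_iff'.2 ⟨σ, fun τ => ?_⟩
  by_cases hτ : τ ∈ H
  · exact Or.inr ⟨hτ, fun h => hσ ((H.mul_mem_cancel_right hτ).1 h)⟩
  · refine Or.inl ⟨?_, hτ⟩
    have hσ' : σ⁻¹ ∉ H := fun h => hσ (by simpa using h)
    rw [hmem] at hσ' hτ ⊢
    have h1 := htrans' σ⁻¹ τ
    rw [inv_inv] at h1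
    have h2 := Finset.card_union_add_card_inter (σ⁻¹ • A \ A) (τ • A \ A)
    have h3 : #(σ⁻¹ • A \ A ∪ τ • A \ A) ≤ #Aᶜ := Finset.card_le_card
      (Finset.union_subset (fun x hx => by simp at hx ⊢; exact hx.2)
        (fun x hx => by simp at hx ⊢; exact hx.2))
    have h4 : #((σ⁻¹ • A \ A) ∩ (τ • A \ A)) ≤ #(σ⁻¹ • A ∩ τ • A) := Finset.card_le_card
      (Finset.inter_subset_inter Finset.sdiff_subset Finset.sdiff_subset)
    have h5 := Finset.card_compl_add_card A
    have h6 := Finset.card_sdiff_add_card_inter (σ⁻¹ • A) A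
    have h7 := Finset.card_sdiff_add_card_inter (τ • A) A
    rw [Finset.card_smul_finset, Finset.inter_comm] at h6 h7
    rcases hdich (σ * τ) with h | h
    · have h8 := hdich σ⁻¹
      have h9 := hdich τ
      omega
    · exact h

omit [Fintype V] [DecidableEq V] in
theorem smul_mem_orbit_iff_of_index_two {H : Subgroup 𝒢} (hH : H.index = 2)
    [MulAction.IsPretransitive 𝒢 V] (hnt : ¬ ∀ v w : V, ∃ g ∈ H, g • v = w) (a : V) (g : 𝒢) (v : V) :
    g • v ∈ MulAction.orbit H a ↔ (g ∈ H ↔ v ∈ MulAction.orbit H a) := by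
  have hmem : ∀ w, w ∈ MulAction.orbit H a ↔ ∃ h ∈ H, h • a = w := by
    intro w
    simp [MulAction.mem_orbit_iff, Subgroup.smul_def]
  have hstab : ∀ s : 𝒢, s • a = a → s ∈ H := by
    intro s hs
    by_contra hsH
    have hall : ∀ w : V, ∃ h ∈ H, h • a = w := by
      intro w
      obtain ⟨k, rfl⟩ := MulAction.exists_smul_eq 𝒢 a w
      by_cases hk : k ∈ H
      · exact ⟨k, hk, rfl⟩
      · refine ⟨k * s, ?_, by rw [mul_smul, hs]⟩
        simp [Subgroup.mul_mem_iff_of_index_two hH, hk, hsH]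
    refine hnt fun v w => ?_
    obtain ⟨h, hh, rfl⟩ := hall v
    obtain ⟨k, hk, rfl⟩ := hall w
    exact ⟨k * h⁻¹, H.mul_mem hk (H.inv_mem hh), by simp [mul_smul]⟩
  have hiff : ∀ k : 𝒢, k • a ∈ MulAction.orbit H a ↔ k ∈ H := by
    intro k
    rw [hmem]
    refine ⟨?_, fun hk => ⟨k, hk, rfl⟩⟩
    rintro ⟨h, hh, hhk⟩
    have := hstab (h⁻¹ * k) (by rw [mul_smul, ← hhk, inv_smul_smul])
    exact (H.mul_mem_cancel_left (H.inv_mem hh)).1 this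
  obtain ⟨k, rfl⟩ := MulAction.exists_smul_eq 𝒢 a v
  rw [smul_smul, hiff, hiff, Subgroup.mul_mem_iff_of_index_two hH]

theorem two_mul_card_of_smul_mem_iff {H : Subgroup 𝒢} (hH : H.index = 2) {O : Finset V}
    (hO : ∀ (g : 𝒢) (v : V), g • v ∈ O ↔ (g ∈ H ↔ v ∈ O)) : 2 * #O = Fintype.card V := by
  obtain ⟨g, hg⟩ := Subgroup.index_eq_two_iff.1 hH
  have hgH : g ∉ H := by simpa [Xor] using hg 1
  have h1 : g • O = Oᶜ := by
    ext v
    rw [← Finset.inv_smul_mem_iff, hO, Finset.mem_compl, inv_mem_iff]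
    tauto
  have h2 := Finset.card_compl_add_card O
  rw [← h1, Finset.card_smul_finset] at h2
  omega

omit [Fintype V] in
/-- A permutation which intertwines the action through an automorphism or an anti-automorphism
maps an orbit of a subgroup of index two either off itself or evenly across its two cosets. -/
theorem disjoint_image_or_card_le {H : Subgroup 𝒢} {O : Finset V} {a : V}
    (hO : ∀ (g : 𝒢) (v : V), g • v ∈ O ↔ (g ∈ H ↔ v ∈ O))
    (hOa : ∀ v, v ∈ O ↔ ∃ h ∈ H, h • a = v) {θ : Equiv.Perm V} {ψ : 𝒢 → 𝒢}
    (hmul : (∀ x y : 𝒢, ψ (x * y) = ψ x * ψ y) ∨ (∀ x y : 𝒢, ψ (x * y) = ψ y * ψ x))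
    (hθ : (∀ g : 𝒢, θ (g • a) = ψ g • θ a) ∨ (∀ g : 𝒢, θ (g • a) = ψ g⁻¹ • θ a)) :
    Disjoint (O.image θ) O ∨ #O ≤ 2 * #(O.image θ ∩ O) := by
  have hZ : ∀ z, z ∈ O.image θ ↔ ∃ h ∈ H, ψ h • θ a = z := by
    intro z
    simp only [Finset.mem_image, hOa]
    constructor
    · rintro ⟨_, ⟨h, hh, rfl⟩, rfl⟩
      rcases hθ with hθ | hθ
      · exact ⟨h, hh, (hθ h).symm⟩
      · exact ⟨h⁻¹, H.inv_mem hh, (hθ h).symm⟩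
    · rintro ⟨h, hh, rfl⟩
      rcases hθ with hθ | hθ
      · exact ⟨_, ⟨h, hh, rfl⟩, hθ h⟩
      · exact ⟨_, ⟨h⁻¹, H.inv_mem hh, rfl⟩, by rw [hθ, inv_inv]⟩
  have hcard : #(O.image θ) = #O := Finset.card_image_of_injective _ θ.injective
  by_cases hψ : ∀ h ∈ H, ψ h ∈ H
  · by_cases ha : θ a ∈ O
    · right
      have : O.image θ ⊆ O := by
        intro z hz
        obtain ⟨h, hh, rfl⟩ := (hZ z).1 hz
        exact (hO _ _).2 (iff_of_true (hψ h hh) ha)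
      rw [Finset.inter_eq_left.2 this]
      omega
    · left
      refine Finset.disjoint_left.2 fun z hz hzO => ?_
      obtain ⟨h, hh, rfl⟩ := (hZ z).1 hz
      exact ha (((hO _ _).1 hzO).1 (hψ h hh))
  · push Not at hψ
    obtain ⟨k, hk, hkH⟩ := hψ
    right
    have hkZ : ∀ z ∈ O.image θ, ψ k • z ∈ O.image θ := by
      intro z hz
      obtain ⟨h, hh, rfl⟩ := (hZ z).1 hz
      rw [smul_smul]
      rcases hmul with hmul | hmul
      · exact (hZ _).2 ⟨k * h, H.mul_mem hk hh, by rw [hmul]⟩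
      · exact (hZ _).2 ⟨h * k, H.mul_mem hh hk, by rw [hmul]⟩
    have hsub : ψ k • (O.image θ \ O) ⊆ O.image θ ∩ O := by
      intro z hz
      obtain ⟨y, hy, rfl⟩ := Finset.mem_smul_finset.1 hz
      obtain ⟨h1, h2⟩ := Finset.mem_sdiff.1 hy
      exact Finset.mem_inter.2 ⟨hkZ y h1, (hO _ _).2 (iff_of_false hkH h2)⟩
    have h1 := Finset.card_le_card hsub
    rw [Finset.card_smul_finset] at h1
    have h2 := Finset.card_sdiff_add_card_inter (O.image θ) O
    omega

/-- If a set `A` with almost half of the vertices is almost independent, and every translate of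
`A` is almost equal to `A` or almost disjoint from it, then the graph is bipartite. -/
theorem exists_bipartition_of_card_inter_smul [Nonempty V]
    (hindex2 : ∀ H : Subgroup 𝒢, H.index = 2 → ¬ ∀ v w : V, ∃ g ∈ H, g • v = w)
    {t : ℕ} (ht : 0 < t) (htrans : ∀ u v : V, {g : 𝒢 | g • u = v}.ncard = t)
    {ι : Type*} {Adj : V → V → Prop} {θ : ι → Equiv.Perm V}
    (hN : ∀ v w : V, Adj v w ↔ ∃ i, w = θ i v)
    (hψ : ∀ i (v : V), ∃ ψ : 𝒢 → 𝒢, Function.Bijective ψ ∧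
      ((∀ x y : 𝒢, ψ (x * y) = ψ x * ψ y) ∨ (∀ x y : 𝒢, ψ (x * y) = ψ y * ψ x)) ∧
      ((∀ g : 𝒢, θ i (g • v) = ψ g • θ i v) ∨ (∀ g : 𝒢, θ i (g • v) = ψ g⁻¹ • θ i v)))
    {A : Finset V} (hA : A.Nonempty)
    (hA₁ : 2 * #A ≤ Fintype.card V) (hA₂ : 8 * Fintype.card V ≤ 17 * #A)
    (hindep : 32 * #(A ∩ nbhdFinset Adj A) ≤ #A)
    (hdich : ∀ τ : 𝒢, 16 * #(A ∩ τ • A) ≤ #A ∨ 15 * #A ≤ 16 * #(A ∩ τ • A)) :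
    ∃ B : Set V, ∀ v w : V, Adj v w → ((v ∈ B ∧ w ∉ B) ∨ (v ∉ B ∧ w ∈ B)) := by
  classical
  have : Finite 𝒢 := finite_of_ncard_smul_eq ht htrans
  have := Fintype.ofFinite 𝒢
  obtain ⟨H, hH, hHA⟩ := exists_index_two_of_card_inter_smul ht htrans hA hA₁ hA₂ hdich
  obtain ⟨a, -, ha⟩ := exists_card_orbit_ge htrans hA (S := {τ | τ ∈ H})
    fun τ hτ => hHA τ (by simpa using hτ)
  have : MulAction.IsPretransitive 𝒢 V := ⟨fun u v =>
    Set.nonempty_of_ncard_ne_zero (s := {g : 𝒢 | g • u = v}) (by rw [htrans u v]; exact ht.ne')⟩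
  set O : Finset V := {b | b ∈ MulAction.orbit H a} with hOdef
  have hOa : ∀ v, v ∈ O ↔ ∃ h ∈ H, h • a = v := fun v => by
    simp [hOdef, MulAction.mem_orbit_iff, Subgroup.smul_def]
  have hO : ∀ (g : 𝒢) (v : V), g • v ∈ O ↔ (g ∈ H ↔ v ∈ O) := fun g v => by
    simpa [hOdef] using smul_mem_orbit_iff_of_index_two hH (hindex2 H hH) a g v
  have hOcard := two_mul_card_of_smul_mem_iff hH hO
  have hAO : 15 * Fintype.card V ≤ 32 * #(O ∩ A) := by
    have h1 : 2 * #{τ : 𝒢 | τ ∈ H} = t * Fintype.card V := by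
      rw [← card_eq_mul_card_of_ncard_smul_eq htrans, ← Nat.card_eq_fintype_card,
        ← H.card_mul_index, hH, mul_comm, Nat.card_eq_fintype_card, Fintype.card_subtype]
    have h2 : ({b ∈ A | ∃ τ ∈ ({τ | τ ∈ H} : Finset 𝒢), τ • a = b} : Finset V) = O ∩ A := by
      ext b
      simp [hOa, and_comm]
    rw [h2] at ha
    refine Nat.le_of_mul_le_mul_left (?_ : t * _ ≤ t * _) ht
    linarith [mul_left_comm t 15 (Fintype.card V), mul_left_comm t 32 #(O ∩ A),
      mul_assoc 16 t #(O ∩ A)]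
  have hOA := Finset.card_sdiff_add_card_inter O A
  have hdisj : ∀ i, Disjoint (O.image (θ i)) O := by
    intro i
    obtain ⟨ψ, -, hmul, hθ⟩ := hψ i a
    refine (disjoint_image_or_card_le hO hOa hmul hθ).resolve_right fun hle => ?_
    have hsub : O.image (θ i) ∩ O ⊆
        (O \ A).image (θ i) ∪ (A ∩ nbhdFinset Adj A) ∪ O \ A := by
      intro z hz
      obtain ⟨h1, h2⟩ := Finset.mem_inter.1 hz
      obtain ⟨y, hy, rfl⟩ := Finset.mem_image.1 h1
      by_cases hyA : y ∈ A
      · by_cases hzA : θ i y ∈ A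
        · exact Finset.mem_union_left _ (Finset.mem_union_right _ (Finset.mem_inter.2
            ⟨hzA, mem_nbhdFinset.2 ⟨y, hyA, (hN _ _).2 ⟨i, rfl⟩⟩⟩))
        · exact Finset.mem_union_right _ (Finset.mem_sdiff.2 ⟨h2, hzA⟩)
      · exact Finset.mem_union_left _ (Finset.mem_union_left _
          (Finset.mem_image_of_mem _ (Finset.mem_sdiff.2 ⟨hy, hyA⟩)))
    have h1 := Finset.card_le_card hsub
    have h2 := Finset.card_union_le ((O \ A).image (θ i) ∪ (A ∩ nbhdFinset Adj A)) (O \ A)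
    have h3 := Finset.card_union_le ((O \ A).image (θ i)) (A ∩ nbhdFinset Adj A)
    have h4 : #((O \ A).image (θ i)) ≤ #(O \ A) := Finset.card_image_le
    have h5 := hA.card_pos
    omega
  refine ⟨O, fun v w hvw => ?_⟩
  obtain ⟨i, rfl⟩ := (hN v w).1 hvw
  have himage : O.image (θ i) = Oᶜ := by
    refine Finset.eq_of_subset_of_card_le
      (fun z hz => Finset.mem_compl.2 (Finset.disjoint_left.1 (hdisj i) hz)) ?_
    rw [Finset.card_image_of_injective _ (θ i).injective]
    have := Finset.card_compl_add_card O
    omega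
  have hiff : θ i v ∉ O ↔ v ∈ O := by
    rw [← Finset.mem_compl, ← himage, Finset.mem_image]
    simp
  simp only [Finset.mem_coe]
  tauto

end Action

theorem sum_apply_eq_of_eigenvector {V : Type*} [Fintype V] [DecidableEq V] {d : ℕ} (hd : 1 ≤ d)
    (θ : Fin d → Equiv.Perm V) {lam : ℝ} {f : V → ℝ} (v : V)
    (h : (∑ w : V, ((univ.filter (fun i : Fin d => θ i v = w)).card : ℝ) / (d : ℝ) * f w)
      = lam * f v) :
    ∑ i, f (θ i v) = d * lam * f v := by
  have hd0 : (d : ℝ) ≠ 0 := by positivity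
  rw [mul_assoc, ← h, Finset.mul_sum]
  have h1 : ∀ w, (d : ℝ) * ((#{i : Fin d | θ i v = w} : ℝ) / d * f w)
      = ∑ i, if θ i v = w then f w else 0 := by
    intro w
    rw [← Finset.sum_filter, Finset.sum_const, nsmul_eq_mul]
    field_simp
  rw [Finset.sum_congr rfl fun w _ => h1 w, Finset.sum_comm]
  simp

theorem sum_sq_sub_of_eigenvector {V : Type*} [Fintype V] {d : ℕ}
    (θ : Fin d → Equiv.Perm V) {lam : ℝ} {f : V → ℝ}
    (h : ∀ v, ∑ i, f (θ i v) = d * lam * f v) :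
    ∑ e : V × Fin d × Fin d, (f (θ e.2.1 e.1) - f (θ e.2.2 e.1)) ^ 2
      = 2 * d ^ 2 * (1 - lam ^ 2) * ∑ v, f v ^ 2 := by
  have hperm : ∑ v, ∑ i, f (θ i v) ^ 2 = d * ∑ v, f v ^ 2 := by
    rw [Finset.sum_comm, Finset.sum_congr rfl fun i _ => Equiv.sum_comp (θ i) fun v => f v ^ 2]
    simp
  have hv : ∀ v, ∑ i, ∑ j, (f (θ i v) - f (θ j v)) ^ 2
      = 2 * d * ∑ i, f (θ i v) ^ 2 - 2 * (d * lam * f v) ^ 2 := by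
    intro v
    have h1 : ∀ i j, (f (θ i v) - f (θ j v)) ^ 2
        = f (θ i v) ^ 2 + f (θ j v) ^ 2 - 2 * (f (θ i v) * f (θ j v)) := fun i j => by ring
    simp only [h1, Finset.sum_add_distrib, Finset.sum_sub_distrib, ← Finset.mul_sum,
      ← Finset.sum_mul, h v]
    simp only [Finset.sum_const, Finset.card_univ, Fintype.card_fin, nsmul_eq_mul,
      ← Finset.mul_sum]
    ring
  rw [Fintype.sum_prod_type, Finset.sum_congr rfl fun v _ => Fintype.sum_prod_type _,
    Finset.sum_congr rfl fun v _ => hv v, Finset.sum_sub_distrib, ← Finset.mul_sum, hperm,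
    ← Finset.mul_sum, Finset.sum_congr rfl fun v _ => mul_pow (d * lam) (f v) 2, ← Finset.mul_sum]
  ring

/-- An eigenvalue close to `-1` produces a set which is almost invariant under the two-step
neighbourhood. -/
theorem exists_card_nbhdFinset_nbhdFinset_sdiff_le {V : Type*} [Fintype V] [DecidableEq V]
    {d : ℕ} {θ : Fin d → Equiv.Perm V} {Adj : V → V → Prop}
    (hsymm : ∀ v w : V, Adj v w → Adj w v) (hN : ∀ v w : V, Adj v w ↔ ∃ i : Fin d, w = θ i v)
    {lam : ℝ} {f : V → ℝ} (hf : f ≠ 0) (hf0 : ∑ v, f v = 0)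
    (h : ∀ v, ∑ i, f (θ i v) = d * lam * f v) {c : ℝ} (hc : 0 ≤ c)
    (hlam : 2 * d ^ 4 * (1 - lam ^ 2) ≤ c ^ 2) :
    ∃ A : Finset V, A.Nonempty ∧ 2 * #A ≤ Fintype.card V ∧
      (#(nbhdFinset Adj (nbhdFinset Adj A) \ A) : ℝ) ≤ c * #A := by
  obtain ⟨A, hA, hA2, hle⟩ := exists_card_boundary_le
    (fun e : V × Fin d × Fin d => θ e.2.1 e.1) (fun e => θ e.2.2 e.1) (d ^ 2) (by positivity)
    (fun g => by
      rw [Fintype.sum_prod_type_right, Finset.sum_congr rfl fun p _ => Equiv.sum_comp (θ p.1) g]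
      simp [sq])
    (fun F => by
      rw [Fintype.sum_prod_type, Fintype.sum_prod_type]
      refine Finset.sum_congr rfl fun v _ => ?_
      rw [Fintype.sum_prod_type, Fintype.sum_prod_type_right])
    c hc f hf hf0
    (by
      rw [sum_sq_sub_of_eigenvector θ h]
      have := mul_le_mul_of_nonneg_right hlam (Finset.sum_nonneg fun v _ => sq_nonneg (f v) :
        0 ≤ ∑ v, f v ^ 2)
      linarith)
  refine ⟨A, hA, hA2, le_trans ?_ hle⟩
  norm_cast
  refine (Finset.card_le_card fun w hw => ?_).trans
    (Finset.card_image_le (f := fun e : V × Fin d × Fin d => θ e.2.2 e.1))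
  obtain ⟨h1, h2⟩ := Finset.mem_sdiff.1 hw
  obtain ⟨v, hv, hvw⟩ := mem_nbhdFinset.1 h1
  obtain ⟨u, hu, huv⟩ := mem_nbhdFinset.1 hv
  obtain ⟨i, rfl⟩ := (hN _ _).1 (hsymm _ _ huv)
  obtain ⟨j, rfl⟩ := (hN _ _).1 hvw
  exact Finset.mem_image.2 ⟨(v, i, j), by simpa using ⟨hu, h2⟩, rfl⟩

/-- Let `(V,E)` be a finite undirected non-bipartite graph with `|V| ≥ 4`, whose
adjacency is realised by `d ≥ 1` permutations `θ₁,…,θ_d` of `V`, and let `𝒢` act on `V` such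
that: (1) no index-two subgroup of `𝒢` acts transitively on `V`; (2) the action is transitive
with all point stabilizers of the same cardinality `t`, i.e. every equation `g • u = v` has
exactly `t` solutions; (3) each `θᵢ` intertwines the action via an automorphism or
anti-automorphism `ψ` of `𝒢` (possibly after inverting); (4) `N(N(τ·A)) ⊆ τ·(N(N(A)))` for all
`τ ∈ 𝒢`, `A ⊆ V`. If `(V,E)` is an `ε`-vertex expander with `ε > 0`, then every nontrivial
eigenvalue of the normalised adjacency operator of `(V,E)` is `> -1 + ε⁴/(2¹²·d⁸)`. -/
theorem stmt_5 {V : Type*} [Fintype V] [DecidableEq V]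
    {𝒢 : Type*} [Group 𝒢] [MulAction 𝒢 V]
    (hV : 4 ≤ Fintype.card V)
    (Adj : V → V → Prop)
    (hundirected : ∀ v w : V, Adj v w → Adj w v)
    (hnonbip : ¬ ∃ B : Set V, ∀ v w : V, Adj v w →
      ((v ∈ B ∧ w ∉ B) ∨ (v ∉ B ∧ w ∈ B)))
    (d : ℕ) (hd : 1 ≤ d)
    (θ : Fin d → Equiv.Perm V)
    (hadj : ∀ (i : Fin d) (v : V), Adj v (θ i v))
    (hN : ∀ v w : V, Adj v w ↔ ∃ i : Fin d, w = θ i v)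
    (hindex2 : ∀ H : Subgroup 𝒢, H.index = 2 → ¬ ∀ v w : V, ∃ g ∈ H, g • v = w)
    (t : ℕ) (ht : 0 < t)
    (htrans : ∀ u v : V, {g : 𝒢 | g • u = v}.ncard = t)
    (hψ : ∀ (i : Fin d) (v : V), ∃ ψ : 𝒢 → 𝒢, Function.Bijective ψ ∧
      ((∀ x y : 𝒢, ψ (x * y) = ψ x * ψ y) ∨ (∀ x y : 𝒢, ψ (x * y) = ψ y * ψ x)) ∧
      ((∀ g : 𝒢, θ i (g • v) = ψ g • θ i v) ∨ (∀ g : 𝒢, θ i (g • v) = ψ g⁻¹ • θ i v)))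
    (hcomm : ∀ (τ : 𝒢) (A : Set V),
      nbhd Adj (nbhd Adj ((τ • ·) '' A)) ⊆ (τ • ·) '' nbhd Adj (nbhd Adj A))
    (ε : ℝ) (hε : 0 < ε)
    (hexp : ∀ A : Set V, A.Nonempty → 2 * A.ncard ≤ Fintype.card V →
      ε * (A.ncard : ℝ) ≤ ((nbhd Adj A \ A).ncard : ℝ))
    (lam : ℝ)
    (hlam : ∃ f : V → ℝ, f ≠ 0 ∧ (∑ v : V, f v) = 0 ∧
      ∀ v : V,
        (∑ w : V, ((Finset.univ.filter (fun i : Fin d => θ i v = w)).card : ℝ) / (d : ℝ) * f w)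
          = lam * f v) :
    -1 + ε ^ 4 / (2 ^ 12 * (d : ℝ) ^ 8) < lam := by
  have hdR : (1 : ℝ) ≤ d := mod_cast hd
  have hVne : Nonempty V := Fintype.card_pos_iff.1 (by omega)
  have hexp' : ∀ A : Finset V, A.Nonempty → 2 * #A ≤ Fintype.card V →
      ε * #A ≤ #(nbhdFinset Adj A \ A) := by
    intro A hA hA2
    have := hexp A hA (by rwa [Set.ncard_coe_finset])
    rwa [← coe_nbhdFinset, ← Finset.coe_sdiff, Set.ncard_coe_finset, Set.ncard_coe_finset] at this
  have hcomm' : ∀ (τ : 𝒢) (A : Finset V),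
      nbhdFinset Adj (nbhdFinset Adj (τ • A)) ⊆ τ • nbhdFinset Adj (nbhdFinset Adj A) := by
    intro τ A
    have := hcomm τ A
    rw [← Finset.coe_subset]
    simpa only [coe_nbhdFinset, Finset.coe_smul_finset, ← Set.image_smul] using this
  have hεd : ε ≤ d := by
    obtain ⟨v⟩ := hVne
    have h1 := hexp' {v} (Finset.singleton_nonempty v) (by simp; omega)
    have h2 : #(nbhdFinset Adj {v} \ {v}) ≤ d * #{v} :=
      (Finset.card_le_card Finset.sdiff_subset).trans (card_nbhdFinset_le hN _)
    have h3 : (#(nbhdFinset Adj {v} \ {v}) : ℝ) ≤ d * #{v} := mod_cast h2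
    simp only [Finset.card_singleton, Nat.cast_one, mul_one] at h1 h3
    linarith
  by_contra! hle
  obtain ⟨f, hf, hf0, hfeq⟩ := hlam
  obtain ⟨x, hx⟩ : ∃ x, x = ε / d := ⟨_, rfl⟩
  have hx0 : 0 < x := hx ▸ by positivity
  have hx1 : x ≤ 1 := hx ▸ (div_le_one (by positivity)).2 hεd
  have hεx : ε = d * x := by rw [hx]; field_simp
  have hζ : ε ^ 4 / (2 ^ 12 * (d : ℝ) ^ 8) = x ^ 4 / (2 ^ 12 * (d : ℝ) ^ 4) := by
    rw [hεx]; field_simp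
  rw [hζ] at hle
  set ζ := x ^ 4 / (2 ^ 12 * (d : ℝ) ^ 4) with hζdef
  have hζd : ζ * d ^ 4 = x ^ 4 / 2 ^ 12 := by rw [hζdef]; field_simp
  have hd4 : (1 : ℝ) ≤ d ^ 4 := one_le_pow₀ hdR
  have hζ1 : ζ ≤ 1 := by
    refine (div_le_one (by positivity)).2 ?_
    have : x ^ 4 ≤ 1 := pow_le_one₀ hx0.le hx1
    linarith
  have hlam2 : 1 - lam ^ 2 ≤ 2 * ζ := by
    have := pow_le_pow_left₀ (by linarith : 0 ≤ 1 - ζ) (by linarith : 1 - ζ ≤ -lam) 2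
    nlinarith [sq_nonneg ζ]
  set c := x ^ 2 / 32 with hc
  have hc0 : 0 ≤ c := by positivity
  obtain ⟨A, hA, hA₁, hAc⟩ := exists_card_nbhdFinset_nbhdFinset_sdiff_le hundirected hN hf hf0
    (fun v => sum_apply_eq_of_eigenvector hd θ v (hfeq v)) hc0
    (by
      have h1 := mul_le_mul_of_nonneg_left hlam2 (by positivity : (0 : ℝ) ≤ 2 * d ^ 4)
      have h2 : c ^ 2 = 4 * (ζ * d ^ 4) := by rw [hζd, hc]; ring
      linarith)
  have hApos : (0 : ℝ) < #A := mod_cast hA.card_pos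
  have hA₁' : 2 * (#A : ℝ) ≤ Fintype.card V := mod_cast hA₁
  have hc1 : c * #A ≤ #A / 32 := by
    have : c ≤ 1 / 32 := by rw [hc]; nlinarith
    nlinarith
  have hdc : d * (c * #A) ≤ ε * (#A / 32) := by
    have : d * c ≤ ε * (1 / 32) := by
      rw [hc, hεx]
      nlinarith [mul_pos (by linarith : (0 : ℝ) < d) hx0]
    nlinarith
  have hcε : c * #A ≤ ε * (#A / 32) := by
    have : 0 ≤ c * #A := mul_nonneg hc0 hApos.le
    nlinarith
  refine hnonbip (exists_bipartition_of_card_inter_smul hindex2 ht htrans hN hψ hA hA₁ ?_ ?_ ?_)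
  · rcases small_or_large_of_card_sdiff_le hd hundirected hN hε hexp' hAc with h | h
    · nlinarith
    · have := le_of_mul_le_mul_left (h.trans hdc) hε
      have h2 : 8 * (Fintype.card V : ℝ) ≤ 17 * #A := by linarith
      exact_mod_cast h2
  · have h1 := (mul_card_inter_nbhdFinset_le hexp' hA₁).trans (hAc.trans hcε)
    have h2 : 32 * (#(A ∩ nbhdFinset Adj A) : ℝ) ≤ #A := by
      have := le_of_mul_le_mul_left h1 hε
      linarith
    exact_mod_cast h2
  · intro τ
    have hB : (#(nbhdFinset Adj (nbhdFinset Adj (A ∩ τ • A)) \ (A ∩ τ • A)) : ℝ)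
        ≤ 2 * (c * #A) := by
      set M : Finset V := nbhdFinset Adj (nbhdFinset Adj A) with hM
      have hsub : nbhdFinset Adj (nbhdFinset Adj (A ∩ τ • A)) \ (A ∩ τ • A)
          ⊆ (M \ A) ∪ τ • (M \ A) := by
        intro w hw
        obtain ⟨h1, h2⟩ := Finset.mem_sdiff.1 hw
        have h3 : w ∈ M := nbhdFinset_mono (nbhdFinset_mono Finset.inter_subset_left) h1
        have h4 : w ∈ τ • M := hcomm' τ A
          (nbhdFinset_mono (nbhdFinset_mono Finset.inter_subset_right) h1)
        by_cases hwA : w ∈ A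
        · refine Finset.mem_union_right _ ?_
          rw [Finset.smul_finset_sdiff]
          exact Finset.mem_sdiff.2 ⟨h4, fun h => h2 (Finset.mem_inter.2 ⟨hwA, h⟩)⟩
        · exact Finset.mem_union_left _ (Finset.mem_sdiff.2 ⟨h3, hwA⟩)
      have h1 := (Finset.card_le_card hsub).trans (Finset.card_union_le _ _)
      rw [Finset.card_smul_finset] at h1
      have h2 : (#(nbhdFinset Adj (nbhdFinset Adj (A ∩ τ • A)) \ (A ∩ τ • A)) : ℝ)
          ≤ #(M \ A) + #(M \ A) := mod_cast h1
      linarith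
    rcases small_or_large_of_card_sdiff_le hd hundirected hN hε hexp' hB with h | h
    · left
      have h1 : ε * #(A ∩ τ • A) ≤ ε * (#A / 16) := by linarith
      have h2 : 16 * (#(A ∩ τ • A) : ℝ) ≤ #A := by
        have := le_of_mul_le_mul_left h1 hε
        linarith
      exact_mod_cast h2
    · right
      have h1 : ε * (Fintype.card V - 2 * #(A ∩ τ • A) - 2 * (c * #A)) ≤ ε * (#A / 16) := by
        linarith
      have h2 : 15 * (#A : ℝ) ≤ 16 * #(A ∩ τ • A) := by
        have := le_of_mul_le_mul_left h1 hε
        linarith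
      exact_mod_cast h2
end
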